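/- arXiv:2012.00539 — 2 statements merged into one kernel-verified Lean document; each statement's English description precedes it below -/
import Mathlib

section
/- Let ℋ⁻(τ) := (1/(4√π)) Σ_{n≥1} n Γ(−1/2, 4πn²v) e^{−2πin²τ} + 1/(8π√v) for τ = u+iv ∈ ℍ. Then Δ_{3/2}(ℋ⁻) = 0, i.e. ℋ⁻ is annihilated by the weight-3/2 hyperbolic Laplacian. -/
open Complex MeasureTheory

noncomputable section

/-- The incomplete Gamma value Γ(−1/2, x) = ∫ₓ^∞ e^{−t} t^{−3/2} dt. -/
def incGammaNegHalf (x : ℝ) : ℝ := ∫ t in Set.Ioi x, Real.exp (-t) * t ^ (-(3:ℝ)/2)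

/-- The partial derivative ∂f/∂u (in the direction of the real axis). -/
def du (f : ℂ → ℂ) (τ : ℂ) : ℂ := fderiv ℝ f τ 1

/-- The partial derivative ∂f/∂v (in the direction of the imaginary axis). -/
def dv (f : ℂ → ℂ) (τ : ℂ) : ℂ := fderiv ℝ f τ Complex.I

/-- The weight-3/2 hyperbolic Laplacian
Δ_{3/2} = −v²(∂²/∂u² + ∂²/∂v²) + (3/2) i v (∂/∂u + i ∂/∂v). -/
def laplacianThreeHalves (f : ℂ → ℂ) (τ : ℂ) : ℂ :=
  -((τ.im : ℂ)^2) * (du (du f) τ + dv (dv f) τ)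
  + (3/2) * Complex.I * (τ.im : ℂ) * (du f τ + Complex.I * dv f τ)

/-- The nonholomorphic part ℋ⁻ of Zagier's function. -/
def zagierHminus (z : ℂ) : ℂ :=
  (1 / (4 * Real.sqrt Real.pi)) *
      ∑' n : ℕ, ((n : ℂ) + 1) * (incGammaNegHalf (4 * Real.pi * ((n : ℝ) + 1)^2 * z.im) : ℂ) *
        Complex.exp (-2 * Real.pi * Complex.I * ((n : ℂ) + 1)^2 * z)
  + 1 / (8 * Real.pi * Real.sqrt z.im)

/-- `f` is real differentiable at `τ` with partial derivatives `p` and `q` along the real and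
imaginary axes. -/
def HasPartialsAt (f : ℂ → ℂ) (p q : ℂ) (τ : ℂ) : Prop :=
  HasFDerivAt f (reCLM.smulRight p + imCLM.smulRight q) τ

namespace HasPartialsAt

variable {f g : ℂ → ℂ} {p q p' q' τ : ℂ}

lemma du_eq (h : HasPartialsAt f p q τ) : du f τ = p := by
  simp [du, HasFDerivAt.fderiv h]

lemma dv_eq (h : HasPartialsAt f p q τ) : dv f τ = q := by
  simp [dv, HasFDerivAt.fderiv h]

lemma congr (h : HasPartialsAt f p q τ) (hp : p = p') (hq : q = q') :
    HasPartialsAt f p' q' τ := hp ▸ hq ▸ h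

lemma congr_of_eventuallyEq (h : HasPartialsAt f p q τ) (hgf : g =ᶠ[nhds τ] f) :
    HasPartialsAt g p q τ := HasFDerivAt.congr_of_eventuallyEq h hgf

lemma add (hf : HasPartialsAt f p q τ) (hg : HasPartialsAt g p' q' τ) :
    HasPartialsAt (fun z => f z + g z) (p + p') (q + q') τ := by
  refine (HasFDerivAt.fun_add hf hg).congr_fderiv ?_
  ext x; simp; ring

lemma mul (hf : HasPartialsAt f p q τ) (hg : HasPartialsAt g p' q' τ) :
    HasPartialsAt (fun z => f z * g z) (p * g τ + f τ * p') (q * g τ + f τ * q') τ := by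
  refine (HasFDerivAt.fun_mul hf hg).congr_fderiv ?_
  ext x; simp; ring

lemma const_mul (c : ℂ) (hf : HasPartialsAt f p q τ) :
    HasPartialsAt (fun z => c * f z) (c * p) (c * q) τ := by
  refine (HasFDerivAt.const_mul hf c).congr_fderiv ?_
  ext x; simp; ring

end HasPartialsAt

lemma HasDerivAt.hasPartialsAt {f : ℂ → ℂ} {f' τ : ℂ} (h : HasDerivAt f f' τ) :
    HasPartialsAt f f' (I * f') τ := by
  refine (h.hasFDerivAt.restrictScalars ℝ).congr_fderiv ?_
  ext x
  simp
  linear_combination -f' * re_add_im x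

lemma HasDerivAt.hasPartialsAt_comp_im {g : ℝ → ℝ} {g' : ℝ} {τ : ℂ} (h : HasDerivAt g g' τ.im) :
    HasPartialsAt (fun z => (g z.im : ℂ)) 0 g' τ := by
  have h1 : HasDerivAt (fun y : ℝ => (g y : ℂ)) (g' : ℂ) (imCLM τ) := h.ofReal_comp
  refine (h1.hasFDerivAt.comp τ imCLM.hasFDerivAt).congr_fderiv ?_
  ext x; simp

/-- Termwise differentiation of a series on a half plane `im z > ε`. -/
lemma hasPartialsAt_tsum {f p q : ℕ → ℂ → ℂ} {u : ℕ → ℝ} {ε : ℝ} {τ : ℂ} (hτ : ε < τ.im)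
    (hu : Summable u)
    (hf : ∀ n z, ε < z.im → HasPartialsAt (f n) (p n z) (q n z) z)
    (hfu : ∀ n z, ε < z.im → ‖f n z‖ ≤ u n) (hpu : ∀ n z, ε < z.im → ‖p n z‖ ≤ u n)
    (hqu : ∀ n z, ε < z.im → ‖q n z‖ ≤ u n) :
    HasPartialsAt (fun z => ∑' n, f n z) (∑' n, p n τ) (∑' n, q n τ) τ := by
  have hp : Summable fun n => p n τ := .of_norm_bounded hu fun n => hpu n τ hτ
  have hq : Summable fun n => q n τ := .of_norm_bounded hu fun n => hqu n τ hτ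
  have hb : ∀ n z, ε < z.im →
      ‖(reCLM.smulRight (p n z) + imCLM.smulRight (q n z) : ℂ →L[ℝ] ℂ)‖ ≤ u n + u n := by
    intro n z hz
    refine (norm_add_le _ _).trans ?_
    simp only [ContinuousLinearMap.norm_smulRight_apply, reCLM_norm, imCLM_norm, one_mul]
    exact add_le_add (hpu n z hz) (hqu n z hz)
  have key := hasFDerivAt_tsum_of_isPreconnected (s := {z : ℂ | ε < z.im}) (hu.add hu)
    (isOpen_lt continuous_const continuous_im) (convex_halfSpace_im_gt ε).isPreconnected hf hb hτ
    (.of_norm_bounded hu fun n => hfu n τ hτ) hτ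
  refine key.congr_fderiv ?_
  refine HasSum.tsum_eq ?_
  have h1 := (ContinuousLinearMap.smulRightL ℝ ℂ ℂ reCLM).hasSum hp.hasSum
  have h2 := (ContinuousLinearMap.smulRightL ℝ ℂ ℂ imCLM).hasSum hq.hasSum
  simpa using h1.add h2

lemma integrableOn_exp_neg_mul_rpow {x : ℝ} (hx : 0 < x) :
    IntegrableOn (fun t : ℝ => Real.exp (-t) * t ^ (-(3:ℝ)/2)) (Set.Ioi x) := by
  refine (integrableOn_Ioi_rpow_of_lt (a := -(3:ℝ)/2) (by norm_num) hx).mono' (by fun_prop) ?_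
  filter_upwards [ae_restrict_mem measurableSet_Ioi] with t ht
  have ht0 : 0 < t := hx.trans ht
  rw [Real.norm_of_nonneg (by positivity)]
  exact mul_le_of_le_one_left (by positivity) (Real.exp_le_one_iff.2 (by linarith))

lemma hasDerivAt_incGammaNegHalf {x : ℝ} (hx : 0 < x) :
    HasDerivAt incGammaNegHalf (-(Real.exp (-x) * x ^ (-(3:ℝ)/2))) x := by
  have hc : ContinuousOn (fun t : ℝ => Real.exp (-t) * t ^ (-(3:ℝ)/2)) (Set.Ioi 0) :=
    (by fun_prop : Continuous fun t : ℝ => Real.exp (-t)).continuousOn.mul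
      fun t ht => (Real.continuousAt_rpow_const t _ (Or.inl (ne_of_gt ht))).continuousWithinAt
  have hsub : Set.uIcc 1 x ⊆ Set.Ioi 0 := fun t ht =>
    (lt_min one_pos hx).trans_le ht.1
  have key := intervalIntegral.integral_hasDerivAt_right (hc.mono hsub).intervalIntegrable
    (hc.stronglyMeasurableAtFilter isOpen_Ioi x hx) (hc.continuousAt (Ioi_mem_nhds hx))
  refine (key.const_sub (incGammaNegHalf 1)).congr_of_eventuallyEq ?_
  filter_upwards [Ioi_mem_nhds hx] with y hy
  rw [← intervalIntegral.integral_Ioi_sub_Ioi' (integrableOn_exp_neg_mul_rpow one_pos)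
    (integrableOn_exp_neg_mul_rpow hy)]
  simp [incGammaNegHalf]

lemma incGammaNegHalf_nonneg {x : ℝ} (hx : 0 < x) : 0 ≤ incGammaNegHalf x :=
  setIntegral_nonneg measurableSet_Ioi fun t ht => by
    have : 0 < t := hx.trans ht
    positivity

lemma exists_incGammaNegHalf_le {δ : ℝ} (hδ : 0 < δ) :
    ∃ C : ℝ, 0 ≤ C ∧ ∀ x, δ ≤ x → incGammaNegHalf x ≤ C * Real.exp (-x) := by
  have hint := integrableOn_Ioi_rpow_of_lt (a := -(3:ℝ)/2) (by norm_num) hδ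
  have hnn : ∀ t ∈ Set.Ioi δ, 0 ≤ t ^ (-(3:ℝ)/2) := fun t ht => by
    have : 0 < t := hδ.trans ht
    positivity
  refine ⟨∫ t in Set.Ioi δ, t ^ (-(3:ℝ)/2), setIntegral_nonneg measurableSet_Ioi hnn,
    fun x hx => ?_⟩
  have hx0 := hδ.trans_le hx
  calc incGammaNegHalf x ≤ ∫ t in Set.Ioi x, Real.exp (-x) * t ^ (-(3:ℝ)/2) := by
        refine setIntegral_mono_on (integrableOn_exp_neg_mul_rpow hx0)
          ((integrableOn_Ioi_rpow_of_lt (by norm_num) hx0).const_mul _) measurableSet_Ioi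
          fun t ht => ?_
        have ht0 : 0 < t := hx0.trans ht
        have ht' : x < t := ht
        gcongr
    _ = Real.exp (-x) * ∫ t in Set.Ioi x, t ^ (-(3:ℝ)/2) := integral_const_mul _ _
    _ ≤ Real.exp (-x) * ∫ t in Set.Ioi δ, t ^ (-(3:ℝ)/2) := by
        refine mul_le_mul_of_nonneg_left ?_ (Real.exp_pos _).le
        refine setIntegral_mono_set hint ?_ (LE.le.eventuallyLE <| Set.Ioi_subset_Ioi hx)
        filter_upwards [ae_restrict_mem measurableSet_Ioi] with t ht using hnn t ht
    _ = _ := mul_comm _ _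

/-- The `n`-th exponential factor `exp (-2πi (n+1)² z)`. -/
def expTerm (n : ℕ) (z : ℂ) : ℂ := Complex.exp (-2 * Real.pi * Complex.I * ((n : ℂ) + 1)^2 * z)

/-- The terms of the incomplete Gamma series with an additional weight `(n+1)^k`. -/
def gammaTerm (k n : ℕ) (z : ℂ) : ℂ :=
  ((n : ℂ) + 1) ^ (k + 1) * (incGammaNegHalf (4 * Real.pi * ((n : ℝ) + 1)^2 * z.im) : ℂ) *
    expTerm n z

/-- The terms of the antiholomorphic theta series with weight `(n+1)^k`. -/
def thetaTerm (k n : ℕ) (z : ℂ) : ℂ :=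
  ((n : ℂ) + 1) ^ k * (Real.exp (-(4 * Real.pi * ((n : ℝ) + 1)^2 * z.im)) : ℂ) * expTerm n z

lemma norm_expTerm (n : ℕ) (z : ℂ) :
    ‖expTerm n z‖ = Real.exp (2 * Real.pi * ((n : ℝ) + 1)^2 * z.im) := by
  rw [expTerm, Complex.norm_exp]
  congr 1
  have : -2 * (Real.pi : ℂ) * I * ((n : ℂ) + 1)^2 * z
      = ((-2 * Real.pi * ((n : ℝ) + 1)^2 : ℝ) : ℂ) * (I * z) := by push_cast; ring
  rw [this, re_ofReal_mul]
  simp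

lemma hasPartialsAt_expTerm (n : ℕ) (z : ℂ) :
    HasPartialsAt (expTerm n) (-2 * Real.pi * I * ((n : ℂ) + 1)^2 * expTerm n z)
      (2 * Real.pi * ((n : ℂ) + 1)^2 * expTerm n z) z := by
  have h : HasDerivAt (expTerm n) (-2 * Real.pi * I * ((n : ℂ) + 1)^2 * expTerm n z) z := by
    have := ((hasDerivAt_id z).const_mul (-2 * (Real.pi : ℂ) * I * ((n : ℂ) + 1)^2)).cexp
    refine this.congr_deriv ?_
    simp [expTerm]; ring
  refine h.hasPartialsAt.congr rfl ?_
  linear_combination (-2 * Real.pi * ((n : ℂ) + 1)^2 * expTerm n z) * I_sq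

lemma hasPartialsAt_thetaTerm (k n : ℕ) (z : ℂ) :
    HasPartialsAt (thetaTerm k n) (-2 * Real.pi * I * thetaTerm (k + 2) n z)
      (-2 * Real.pi * thetaTerm (k + 2) n z) z := by
  have h := ((((hasDerivAt_id z.im).const_mul (4 * Real.pi * ((n : ℝ) + 1)^2)).fun_neg.exp
    ).hasPartialsAt_comp_im.const_mul (((n : ℂ) + 1) ^ k)).mul (hasPartialsAt_expTerm n z)
  refine HasPartialsAt.congr h ?_ ?_ <;>
  · simp only [thetaTerm, id]; push_cast; ring

lemma rpow_neg_three_halves {x : ℝ} (hx : 0 < x) : x ^ (-(3:ℝ)/2) = (x * √x)⁻¹ := by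
  rw [show -(3:ℝ)/2 = -(1 + 1/2) by norm_num, Real.rpow_neg hx.le, Real.rpow_add hx,
    Real.rpow_one, Real.sqrt_eq_rpow]

lemma hasPartialsAt_gammaTerm (k n : ℕ) {z : ℂ} (hz : 0 < z.im) :
    HasPartialsAt (gammaTerm k n) (-2 * Real.pi * I * gammaTerm (k + 2) n z)
      (2 * Real.pi * gammaTerm (k + 2) n z +
        -(2 * √Real.pi * (z.im * √z.im) : ℂ)⁻¹ * thetaTerm k n z) z := by
  have hpos : 0 < 4 * Real.pi * ((n : ℝ) + 1)^2 * z.im := by positivity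
  have hd : HasDerivAt (fun y => incGammaNegHalf (4 * Real.pi * ((n : ℝ) + 1)^2 * y))
      (-(2 * √Real.pi * (z.im * √z.im))⁻¹ * (((n : ℝ) + 1))⁻¹ *
        Real.exp (-(4 * Real.pi * ((n : ℝ) + 1)^2 * z.im))) z.im := by
    have h1 := (hasDerivAt_incGammaNegHalf hpos).comp z.im
      ((hasDerivAt_id z.im).const_mul (4 * Real.pi * ((n : ℝ) + 1)^2))
    refine h1.congr_deriv ?_
    have hs : √(4 * Real.pi * ((n : ℝ) + 1)^2 * z.im) = 2 * √Real.pi * ((n : ℝ) + 1) * √z.im := by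
      rw [Real.sqrt_mul (by positivity), Real.sqrt_mul (by positivity),
        Real.sqrt_mul (by positivity), Real.sqrt_sq (by positivity),
        show (4 : ℝ) = 2 ^ 2 by norm_num, Real.sqrt_sq (by positivity)]
    rw [rpow_neg_three_halves hpos, hs]
    field_simp
  have h := (hd.hasPartialsAt_comp_im.const_mul (((n : ℂ) + 1) ^ (k + 1))).mul
    (hasPartialsAt_expTerm n z)
  have hn : (n : ℂ) + 1 ≠ 0 := by exact_mod_cast n.succ_ne_zero
  refine HasPartialsAt.congr h ?_ ?_
  · simp only [gammaTerm]; ring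
  · simp only [gammaTerm, thetaTerm]
    push_cast
    field_simp
    ring

/-- A summable majorant for the weighted theta series on `im z > ε`. -/
def majorant (ε : ℝ) (k n : ℕ) : ℝ := ((n : ℝ) + 1) ^ k * Real.exp (-ε * ((n : ℝ) + 1))

lemma summable_majorant {ε : ℝ} (hε : 0 < ε) (k : ℕ) : Summable (majorant ε k) := by
  have := (summable_nat_add_iff 1).2 (Real.summable_pow_mul_exp_neg_nat_mul k hε)
  simpa only [Nat.cast_add, Nat.cast_one] using! this

lemma majorant_nonneg (ε : ℝ) (k n : ℕ) : 0 ≤ majorant ε k n := by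
  unfold majorant; positivity

lemma majorant_mono {ε : ℝ} {k l : ℕ} (h : k ≤ l) (n : ℕ) : majorant ε k n ≤ majorant ε l n := by
  unfold majorant
  have : (1 : ℝ) ≤ (n : ℝ) + 1 := by simp
  gcongr

lemma exp_mul_norm_expTerm_le {ε : ℝ} (hε : 0 < ε) (n : ℕ) {z : ℂ} (hz : ε < z.im) :
    Real.exp (-(4 * Real.pi * ((n : ℝ) + 1)^2 * z.im)) * ‖expTerm n z‖
      ≤ Real.exp (-ε * ((n : ℝ) + 1)) := by
  rw [norm_expTerm, ← Real.exp_add, Real.exp_le_exp]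
  have hn : (0 : ℝ) ≤ n := n.cast_nonneg
  have h1 : ε * ((n : ℝ) + 1) ≤ z.im * ((n : ℝ) + 1)^2 := by
    have : (n : ℝ) + 1 ≤ ((n : ℝ) + 1)^2 := by nlinarith
    exact mul_le_mul hz.le this (by positivity) (hε.trans hz).le
  have h2 : 0 ≤ z.im * ((n : ℝ) + 1)^2 := by have := hε.trans hz; positivity
  nlinarith [Real.pi_gt_three]

lemma norm_thetaTerm_le {ε : ℝ} (hε : 0 < ε) (k n : ℕ) {z : ℂ} (hz : ε < z.im) :
    ‖thetaTerm k n z‖ ≤ majorant ε k n := by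
  have hn : ‖(n : ℂ) + 1‖ = (n : ℝ) + 1 := by exact_mod_cast Complex.norm_natCast (n + 1)
  rw [thetaTerm, norm_mul, norm_mul, norm_pow, hn, Complex.norm_real,
    Real.norm_of_nonneg (Real.exp_pos _).le, mul_assoc, majorant]
  gcongr
  exact exp_mul_norm_expTerm_le hε n hz

lemma exists_norm_gammaTerm_le {ε : ℝ} (hε : 0 < ε) : ∃ C : ℝ, 0 ≤ C ∧
    ∀ (k n : ℕ) (z : ℂ), ε < z.im → ‖gammaTerm k n z‖ ≤ C * majorant ε (k + 1) n := by
  obtain ⟨C, hC, h⟩ := exists_incGammaNegHalf_le hε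
  refine ⟨C, hC, fun k n z hz => ?_⟩
  have hz0 := hε.trans hz
  have hn : ‖(n : ℂ) + 1‖ = (n : ℝ) + 1 := by exact_mod_cast Complex.norm_natCast (n + 1)
  have hle : ε ≤ 4 * Real.pi * ((n : ℝ) + 1)^2 * z.im := by
    have h0 : (0 : ℝ) ≤ n := n.cast_nonneg
    have h1 : 1 ≤ 4 * Real.pi * ((n : ℝ) + 1)^2 :=
      one_le_mul_of_one_le_of_one_le (by linarith [Real.pi_gt_three]) (by nlinarith)
    nlinarith
  rw [gammaTerm, norm_mul, norm_mul, norm_pow, hn, Complex.norm_real,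
    Real.norm_of_nonneg (incGammaNegHalf_nonneg (hε.trans_le hle)), majorant]
  calc _ ≤ ((n : ℝ) + 1) ^ (k + 1) * (C * Real.exp (-(4 * Real.pi * ((n : ℝ) + 1)^2 * z.im))) *
          ‖expTerm n z‖ := by gcongr; exact h _ hle
    _ = C * (((n : ℝ) + 1) ^ (k + 1) *
          (Real.exp (-(4 * Real.pi * ((n : ℝ) + 1)^2 * z.im)) * ‖expTerm n z‖)) := by ring
    _ ≤ _ := by gcongr; exact exp_mul_norm_expTerm_le hε n hz

/-- The incomplete Gamma series with additional weight `(n+1)^k`. -/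
def gammaSeries (k : ℕ) (z : ℂ) : ℂ := ∑' n, gammaTerm k n z

/-- The antiholomorphic theta series with weight `(n+1)^k`. -/
def thetaSeries (k : ℕ) (z : ℂ) : ℂ := ∑' n, thetaTerm k n z

lemma hasPartialsAt_thetaSeries (k : ℕ) {τ : ℂ} (hτ : 0 < τ.im) :
    HasPartialsAt (thetaSeries k) (-2 * Real.pi * I * thetaSeries (k + 2) τ)
      (-2 * Real.pi * thetaSeries (k + 2) τ) τ := by
  have hε : 0 < τ.im / 2 := by positivity
  have hpi : 1 ≤ 2 * Real.pi := by linarith [Real.pi_gt_three]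
  have h := hasPartialsAt_tsum (half_lt_self hτ)
    ((summable_majorant hε (k + 2)).mul_left (2 * Real.pi))
    (fun n z _ => hasPartialsAt_thetaTerm k n z)
    (fun n z hz => ?_) (fun n z hz => ?_) (fun n z hz => ?_)
  · simp only [tsum_mul_left] at h
    exact h
  · refine (norm_thetaTerm_le hε k n hz).trans ((majorant_mono (Nat.le_add_right k 2) n).trans ?_)
    exact le_mul_of_one_le_left (majorant_nonneg _ _ _) hpi
  all_goals
    rw [norm_mul]
    simp only [norm_mul, norm_neg, norm_I, Complex.norm_ofNat, Complex.norm_real, mul_one,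
      Real.norm_of_nonneg Real.pi_pos.le]
    gcongr
    exact norm_thetaTerm_le hε _ n hz

lemma hasPartialsAt_gammaSeries (k : ℕ) {τ : ℂ} (hτ : 0 < τ.im) :
    HasPartialsAt (gammaSeries k) (-2 * Real.pi * I * gammaSeries (k + 2) τ)
      (2 * Real.pi * gammaSeries (k + 2) τ +
        -(2 * √Real.pi * (τ.im * √τ.im) : ℂ)⁻¹ * thetaSeries k τ) τ := by
  set ε := τ.im / 2 with hε_def
  have hε : 0 < ε := by positivity
  have hετ : ε < τ.im := half_lt_self hτ
  have hpi : 1 ≤ 2 * Real.pi := by linarith [Real.pi_gt_three]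
  obtain ⟨C, hC, hb⟩ := exists_norm_gammaTerm_le hε
  have hM : ∀ n, 0 ≤ majorant ε (k + 3) n := majorant_nonneg ε (k + 3)
  set D := (2 * √Real.pi * (ε * √ε))⁻¹ with hD_def
  have hD : 0 ≤ D := by positivity
  have hg : ∀ n z, ε < z.im →
      2 * Real.pi * ‖gammaTerm (k + 2) n z‖ ≤ 2 * Real.pi * C * majorant ε (k + 3) n := by
    intro n z hz
    rw [mul_assoc (2 * Real.pi)]
    gcongr
    exact hb (k + 2) n z hz
  have hM' : ∀ n, 0 ≤ D * majorant ε (k + 3) n := fun n => mul_nonneg hD (hM n)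
  have h := hasPartialsAt_tsum hετ
    ((summable_majorant hε (k + 3)).mul_left (2 * Real.pi * C + D))
    (fun n z hz => hasPartialsAt_gammaTerm k n (hε.trans hz))
    (fun n z hz => ?_) (fun n z hz => ?_) (fun n z hz => ?_)
  · have hs1 : Summable fun n => gammaTerm (k + 2) n τ :=
      .of_norm_bounded ((summable_majorant hε (k + 3)).mul_left C) fun n => hb (k + 2) n τ hετ
    have hs2 : Summable fun n => thetaTerm k n τ :=
      .of_norm_bounded (summable_majorant hε k) fun n => norm_thetaTerm_le hε k n hετ
    rw [(hs1.mul_left _).tsum_add (hs2.mul_left _)] at h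
    simp only [tsum_mul_left] at h
    exact h
  · have h1 := (hb k n z hz).trans
      (mul_le_mul_of_nonneg_left (majorant_mono (by lia : k + 1 ≤ k + 3) n) hC)
    nlinarith [hM' n, mul_nonneg hC (hM n)]
  · rw [norm_mul]
    simp only [norm_mul, norm_neg, norm_I, Complex.norm_ofNat, Complex.norm_real, mul_one,
      Real.norm_of_nonneg Real.pi_pos.le]
    linarith [hg n z hz, hM' n]
  · refine (norm_add_le _ _).trans ?_
    rw [add_mul]
    refine add_le_add ?_ ?_
    · simp only [norm_mul, Complex.norm_ofNat, Complex.norm_real,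
        Real.norm_of_nonneg Real.pi_pos.le]
      exact hg n z hz
    · rw [norm_mul]
      refine mul_le_mul ?_ ((norm_thetaTerm_le hε k n hz).trans (majorant_mono (by lia) n))
        (norm_nonneg _) hD
      have hz0 := hε.trans hz
      rw [norm_neg, norm_inv]
      simp only [norm_mul, Complex.norm_ofNat, Complex.norm_real,
        Real.norm_of_nonneg (Real.sqrt_nonneg _), Real.norm_of_nonneg hz0.le]
      rw [hD_def]
      gcongr

lemma hasDerivAt_inv_sqrt {x : ℝ} (hx : 0 < x) :
    HasDerivAt (fun y => (√y)⁻¹) (-(1 / 2) * (x * √x)⁻¹) x := by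
  refine ((Real.hasDerivAt_sqrt hx.ne').fun_inv (by positivity)).congr_deriv ?_
  rw [Real.sq_sqrt hx.le]
  field_simp

lemma hasDerivAt_inv_mul_sqrt {x : ℝ} (hx : 0 < x) :
    HasDerivAt (fun y => (y * √y)⁻¹) (-(3 / 2) * (x * √x)⁻¹ / x) x := by
  refine (((hasDerivAt_id x).fun_mul (Real.hasDerivAt_sqrt hx.ne')).fun_inv
    (mul_pos hx (Real.sqrt_pos.2 hx)).ne').congr_deriv ?_
  have := Real.sq_sqrt hx.le
  simp only [id]
  field_simp
  rw [this]; ring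

lemma zagierHminus_eq (z : ℂ) : zagierHminus z =
    (1 / (4 * √Real.pi) : ℂ) * gammaSeries 0 z + (1 / (8 * Real.pi) : ℂ) * ((√z.im)⁻¹ : ℝ) := by
  simp only [zagierHminus, gammaSeries, gammaTerm, expTerm, zero_add, pow_one]
  congr 1
  push_cast
  rw [← div_eq_mul_inv, div_div]

lemma hasPartialsAt_zagierHminus {τ : ℂ} (hτ : 0 < τ.im) :
    HasPartialsAt zagierHminus (-(I * √Real.pi / 2) * gammaSeries 2 τ)
      (√Real.pi / 2 * gammaSeries 2 τ +
        -(1 / (8 * Real.pi) : ℂ) * (((τ.im * √τ.im)⁻¹ : ℝ) * (thetaSeries 0 τ + 1 / 2))) τ := by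
  have h := ((hasPartialsAt_gammaSeries 0 hτ).const_mul (1 / (4 * √Real.pi) : ℂ)).add
    ((hasDerivAt_inv_sqrt hτ).hasPartialsAt_comp_im.const_mul (1 / (8 * Real.pi) : ℂ))
  rw [show zagierHminus = _ from funext zagierHminus_eq]
  have h0 : (√Real.pi : ℂ) ≠ 0 := by exact_mod_cast (Real.sqrt_pos.2 Real.pi_pos).ne'
  have h1 : (Real.pi : ℂ) = (√Real.pi : ℂ) ^ 2 := by
    exact_mod_cast (Real.sq_sqrt Real.pi_pos.le).symm
  refine HasPartialsAt.congr h ?_ ?_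
  · rw [h1]; field_simp; ring
  · have h2 : (τ.im : ℂ) ≠ 0 := by exact_mod_cast hτ.ne'
    have h3 : (√τ.im : ℂ) ≠ 0 := by exact_mod_cast (Real.sqrt_pos.2 hτ).ne'
    push_cast
    rw [h1]; field_simp; ring

/-- ℋ⁻ is annihilated by the weight-3/2 hyperbolic Laplacian. -/
theorem laplacian_zagierHminus (τ : ℂ) (hτ : 0 < τ.im) :
    laplacianThreeHalves zagierHminus τ = 0 := by
  have hmem : ∀ᶠ z : ℂ in nhds τ, 0 < z.im :=
    (isOpen_lt continuous_const continuous_im).mem_nhds hτ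
  have hG := hasPartialsAt_gammaSeries 2 hτ
  have hu : HasPartialsAt (du zagierHminus) _ _ τ :=
    (hG.const_mul (-(I * √Real.pi / 2))).congr_of_eventuallyEq <| by
      filter_upwards [hmem] with z hz using (hasPartialsAt_zagierHminus hz).du_eq
  have hθ : HasPartialsAt (fun z => thetaSeries 0 z + 1 / 2) _ _ τ :=
    HasFDerivAt.add_const _ (hasPartialsAt_thetaSeries 0 hτ)
  have hv : HasPartialsAt (dv zagierHminus) _ _ τ :=
    ((hG.const_mul (√Real.pi / 2)).add (((hasDerivAt_inv_mul_sqrt hτ).hasPartialsAt_comp_im.mul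
      hθ).const_mul (-(1 / (8 * Real.pi) : ℂ)))).congr_of_eventuallyEq <| by
      filter_upwards [hmem] with z hz using (hasPartialsAt_zagierHminus hz).dv_eq
  have h := hasPartialsAt_zagierHminus hτ
  rw [laplacianThreeHalves, hu.du_eq, hv.dv_eq, h.du_eq, h.dv_eq]
  have h0 : (√Real.pi : ℂ) ≠ 0 := by exact_mod_cast (Real.sqrt_pos.2 Real.pi_pos).ne'
  have h1 : (Real.pi : ℂ) = (√Real.pi : ℂ) ^ 2 := by
    exact_mod_cast (Real.sq_sqrt Real.pi_pos.le).symm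
  have h2 : (τ.im : ℂ) ≠ 0 := by exact_mod_cast hτ.ne'
  have h3 : (√τ.im : ℂ) ≠ 0 := by exact_mod_cast (Real.sqrt_pos.2 hτ).ne'
  push_cast
  rw [h1]
  field_simp
  ring_nf
  simp only [I_sq]
  ring

end
end

section
/- Let n be a nonzero integer with n ≡ 0 or 1 (mod 4), and write n = d f² where d is a fundamental discriminant (d = 1 if n is a perfect square) and f is a positive integer. Then for every s ∈ ℂ with Re(s) > 3/2, E_n(s) = (L(s, χ_d)/ζ(2s)) · T_s^{χ_d}(f) / f^{2s−1}, where ζ is the Riemann zeta function. -/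
open Complex

noncomputable section

/-- λ(a,c): i^{(1−c)/2}(a/c) if c odd, a even; i^{a/2}(c/a) if a odd, c even; 0 otherwise,
where i^x := e^{iπx/2}. -/
def lamb (a c : ℕ) : ℂ :=
  if Odd c ∧ Even a then
    Complex.exp (Real.pi * Complex.I * ((1 - (c : ℂ)) / 2) / 2) * (jacobiSym a c : ℂ)
  else if Odd a ∧ Even c then
    Complex.exp (Real.pi * Complex.I * ((a : ℂ) / 2) / 2) * (jacobiSym c a : ℂ)
  else 0

/-- The Gauss sum γ_c(n) = c^{−1/2} Σ_{a=1}^{2c} λ(a,c) e^{−πina/c}. -/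
def gaussG (c : ℕ) (n : ℤ) : ℂ :=
  (c : ℂ) ^ (-(1 : ℂ) / 2) *
    ∑ a ∈ Finset.Icc 1 (2 * c), lamb a c * Complex.exp (-Real.pi * Complex.I * n * a / c)

/-- The Dirichlet series E_n(s) = (1/2) Σ_{c ≥ 1 odd} γ_c(n) c^{−s}
+ (1/2) Σ_{c ≥ 2 even} γ_c(n) (c/2)^{−s}. -/
def En (n : ℤ) (s : ℂ) : ℂ :=
  (1/2) * (∑' c : ℕ, if Odd c then gaussG c n * (c : ℂ) ^ (-s) else 0)
  + (1/2) * (∑' c : ℕ, if Even c ∧ c ≠ 0 then gaussG c n * ((c : ℂ) / 2) ^ (-s) else 0)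

/-- A fundamental discriminant: d = 1, or squarefree d ≡ 1 (mod 4), d ≠ 1,
or d = 4m with m squarefree and m ≡ 2, 3 (mod 4). -/
def IsFundDisc (d : ℤ) : Prop :=
  d = 1 ∨ (Squarefree d ∧ d % 4 = 1 ∧ d ≠ 1) ∨
    ∃ m : ℤ, d = 4 * m ∧ Squarefree m ∧ (m % 4 = 2 ∨ m % 4 = 3)

/-- The value of χ_d at a prime p: (d/p) for odd p; at p = 2 it is 0 if d is even,
1 if d ≡ 1 (mod 8) and −1 if d ≡ 5 (mod 8). -/
def chiPrime (d : ℤ) (p : ℕ) : ℤ :=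
  if p = 2 then (if d % 2 = 0 then 0 else if d % 8 = 1 then 1 else -1)
  else jacobiSym d p

/-- The completely multiplicative character χ_d, extended to ℕ by multiplicativity via
the prime factorization. -/
def chi (d : ℤ) (n : ℕ) : ℤ :=
  n.factorization.prod fun p e => chiPrime d p ^ e

/-- The L-series L(s, χ_d) = Σ_{m ≥ 1} χ_d(m) m^{−s}. -/
def Lchi (d : ℤ) (s : ℂ) : ℂ :=
  ∑' m : ℕ, if m = 0 then 0 else (chi d m : ℂ) * (m : ℂ) ^ (-s)

/-- The divisor sum σ_w(n) = Σ_{t ∣ n} t^w. -/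
def sigmaC (w : ℂ) (n : ℕ) : ℂ := ∑ t ∈ n.divisors, (t : ℂ) ^ w

/-- T_s^{χ}(f) = Σ_{a ∣ f} μ(a) χ(a) a^{s−1} σ_{2s−1}(f/a). -/
def Tchi (d : ℤ) (s : ℂ) (f : ℕ) : ℂ :=
  ∑ a ∈ f.divisors,
    (ArithmeticFunction.moebius a : ℂ) * (chi d a : ℂ) * (a : ℂ) ^ (s - 1) *
      sigmaC (2 * s - 1) (f / a)

/-- The unnormalised quadratic Gauss sum `∑_{k mod c} e^{πiak²/c}`. -/
def quadSum (a : ℤ) (c : ℕ) : ℂ :=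
  ∑ k ∈ Finset.range c, cexp (Real.pi * I * a * (k : ℂ) ^ 2 / c)

theorem summable_exp_neg_mul_int_sq {w : ℂ} (hw : 0 < w.re) :
    Summable fun k : ℤ => cexp (-Real.pi * w * (k : ℂ) ^ 2) := by
  have := (hasSum_jacobiTheta₂_term 0 (τ := I * w) (by simpa using hw)).summable
  refine this.congr fun n => ?_
  rw [jacobiTheta₂_term]
  congr 1
  linear_combination (Real.pi * (n : ℂ) ^ 2 * w) * I_sq

open Filter Topology in
theorem tendsto_tsum_gaussian_twist {ι : Type*} {l : Filter ι} {v : ι → ℂ}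
    (hv : Tendsto (fun i => (v i).re) l atTop) (x : ℝ) :
    Tendsto (fun i => ∑' n : ℤ, cexp (-Real.pi * v i * (n : ℂ) ^ 2 + 2 * Real.pi * I * n * x)) l
      (𝓝 1) := by
  have hnorm : ∀ (z : ℂ) (n : ℤ),
      ‖cexp (-Real.pi * z * (n : ℂ) ^ 2 + 2 * Real.pi * I * n * x)‖ =
        Real.exp (-Real.pi * z.re * (n : ℝ) ^ 2) := by
    intro z n
    rw [norm_exp]
    congr 1
    have : ((n : ℂ) ^ 2) = (((n : ℝ) ^ 2 : ℝ) : ℂ) := by push_cast; rfl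
    rw [this]
    simp [-ofReal_pow]
  have h1 : (1 : ℂ) = ∑' n : ℤ, (if n = 0 then 1 else 0 : ℂ) := by simp
  rw [h1]
  refine tendsto_tsum_of_dominated_convergence
    (bound := fun n : ℤ => Real.exp (-Real.pi * 1 * (n : ℝ) ^ 2)) ?_ ?_ ?_
  · refine (summable_exp_neg_mul_int_sq (w := 1) (by simp)).norm.congr fun n => ?_
    have := hnorm 1 n
    simpa [norm_exp] using this
  · intro n
    by_cases hn : n = 0
    · simp [hn, tendsto_const_nhds]
    · rw [if_neg hn, tendsto_zero_iff_norm_tendsto_zero]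
      simp_rw [hnorm]
      refine Real.tendsto_exp_atBot.comp ?_
      have hpos : 0 < Real.pi * (n : ℝ) ^ 2 := by positivity
      refine ((tendsto_neg_atTop_atBot.comp (hv.atTop_mul_const hpos))).congr fun i => ?_
      simp only [Function.comp]
      ring
  · filter_upwards [hv.eventually_ge_atTop 1] with i hi n
    rw [hnorm]
    apply Real.exp_le_exp.2
    have : 0 ≤ Real.pi * (n : ℝ) ^ 2 := by positivity
    nlinarith

theorem re_inv_pos_iff {w : ℂ} : 0 < (w⁻¹).re ↔ 0 < w.re := by
  by_cases h : w = 0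
  · simp [h]
  · rw [inv_re, div_pos_iff_of_pos_right (normSq_pos.2 h)]

theorem ofReal_mul_cpow_of_pos {r : ℝ} (hr : 0 < r) {z : ℂ} (hz : z ≠ 0) (s : ℂ) :
    ((r : ℂ) * z) ^ s = (r : ℂ) ^ s * z ^ s := by
  have hr0 : (r : ℂ) ≠ 0 := by exact_mod_cast hr.ne'
  rw [cpow_def_of_ne_zero (mul_ne_zero hr0 hz), cpow_def_of_ne_zero hr0, cpow_def_of_ne_zero hz,
    log_ofReal_mul hr hz, ofReal_log hr.le, add_mul, Complex.exp_add]

theorem mul_natCast_sq_cpow_half {w : ℂ} (hw : w ≠ 0) {m : ℕ} (hm : 0 < m) :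
    (w * (m : ℂ) ^ 2) ^ (1 / 2 : ℂ) = m * w ^ (1 / 2 : ℂ) := by
  have : ((m : ℂ) ^ 2) = (((m : ℝ) ^ 2 : ℝ) : ℂ) := by push_cast; rfl
  have hm0 : (m : ℂ) ≠ 0 := by exact_mod_cast hm.ne'
  rw [mul_comm, this, ofReal_mul_cpow_of_pos (by positivity) hw, ← this, sq,
    natCast_mul_natCast_cpow, ← cpow_add _ _ hm0]
  norm_num

theorem cpow_half_mul_tsum_gaussian_residue {w : ℂ} (hw : 0 < w.re) {m : ℕ} (hm : 0 < m) (r : ℕ) :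
    w ^ (1 / 2 : ℂ) * ∑' k : ℤ, cexp (-Real.pi * w * ((m : ℂ) * k + r) ^ 2) =
      1 / m * ∑' n : ℤ, cexp (-Real.pi * (w * (m : ℂ) ^ 2)⁻¹ * (n : ℂ) ^ 2 +
        2 * Real.pi * I * n * (r / m : ℝ)) := by
  have hw0 : w ≠ 0 := by rintro rfl; simp at hw
  have hm0 : (m : ℂ) ≠ 0 := by exact_mod_cast hm.ne'
  have hwm : 0 < (w * (m : ℂ) ^ 2).re := by
    have : ((m : ℂ) ^ 2) = (((m : ℝ) ^ 2 : ℝ) : ℂ) := by push_cast; rfl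
    rw [this, re_mul_ofReal]
    positivity
  have key := Complex.tsum_exp_neg_quadratic hwm (-(w * m * r))
  have e1 : ∀ k : ℤ, cexp (-Real.pi * w * ((m : ℂ) * k + r) ^ 2) =
      cexp (-Real.pi * w * r ^ 2) *
      cexp (-Real.pi * (w * (m : ℂ) ^ 2) * k ^ 2 + 2 * Real.pi * (-(w * m * r)) * k) := by
    intro k
    rw [← Complex.exp_add]
    ring_nf
  have e2 : ∀ n : ℤ, cexp (-Real.pi / (w * (m : ℂ) ^ 2) * (n + I * (-(w * m * r))) ^ 2) =
      cexp (Real.pi * w * r ^ 2) * cexp (-Real.pi * (w * (m : ℂ) ^ 2)⁻¹ * (n : ℂ) ^ 2 +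
        2 * Real.pi * I * n * (r / m : ℝ)) := by
    intro n
    rw [← Complex.exp_add]
    congr 1
    push_cast
    field_simp
    ring_nf
    simp only [I_sq]
    ring
  simp_rw [e1]
  rw [tsum_mul_left, key]
  simp_rw [e2]
  rw [tsum_mul_left, mul_natCast_sq_cpow_half hw0 hm]
  have hne : w ^ (1 / 2 : ℂ) ≠ 0 := by simp [cpow_eq_zero_iff, hw0]
  have hE : cexp (-Real.pi * w * r ^ 2) * cexp (Real.pi * w * r ^ 2) = 1 := by
    rw [← Complex.exp_add]; simp
  generalize (∑' n : ℤ, cexp (-Real.pi * (w * (m : ℂ) ^ 2)⁻¹ * (n : ℂ) ^ 2 +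
        2 * Real.pi * I * n * (r / m : ℝ))) = S
  have hw2 : w ^ (1 / 2 : ℂ) * (1 / (m * w ^ (1 / 2 : ℂ))) = 1 / m := by field_simp
  calc _ = (w ^ (1 / 2 : ℂ) * (1 / (m * w ^ (1 / 2 : ℂ)))) *
        (cexp (-Real.pi * w * r ^ 2) * cexp (Real.pi * w * r ^ 2)) * S := by ring
    _ = _ := by rw [hw2, hE, mul_one]

open Filter Topology in
theorem tendsto_cpow_half_mul_tsum_gaussian {ι : Type*} {l : Filter ι} {w : ι → ℂ}
    (hw : Tendsto (fun i => ((w i)⁻¹).re) l atTop) {m : ℕ} (hm : 0 < m) (h : ℤ → ℂ)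
    (hper : ∀ k j : ℤ, h (m * k + j) = h j) :
    Tendsto (fun i => (w i) ^ (1 / 2 : ℂ) * ∑' k : ℤ, h k * cexp (-Real.pi * w i * (k : ℂ) ^ 2)) l
      (𝓝 (1 / m * ∑ r ∈ Finset.range m, h r)) := by
  have : NeZero m := ⟨hm.ne'⟩
  have hm0 : (m : ℝ) ≠ 0 := by exact_mod_cast hm.ne'
  have hpos : ∀ᶠ i in l, 0 < (w i).re := by
    filter_upwards [hw.eventually_gt_atTop 0] with i hi using re_inv_pos_iff.1 hi
  have hw' : Tendsto (fun i => ((w i * (m : ℂ) ^ 2)⁻¹).re) l atTop := by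
    have hc : 0 < ((m : ℝ) ^ 2)⁻¹ := by positivity
    refine (hw.atTop_mul_const hc).congr fun i => ?_
    have : ((m : ℂ) ^ 2)⁻¹ = ((((m : ℝ) ^ 2)⁻¹ : ℝ) : ℂ) := by push_cast; rfl
    rw [mul_inv, this, re_mul_ofReal]
  have hlim : Tendsto (fun i => ∑ r ∈ Finset.range m, h r * (1 / m * ∑' n : ℤ,
      cexp (-Real.pi * (w i * (m : ℂ) ^ 2)⁻¹ * (n : ℂ) ^ 2 +
        2 * Real.pi * I * n * (r / m : ℝ)))) l (𝓝 (∑ r ∈ Finset.range m, h r * (1 / m * 1))) :=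
    tendsto_finsetSum _ fun r _ =>
      ((tendsto_tsum_gaussian_twist hw' (r / m : ℝ)).const_mul _).const_mul _
  have hval : (∑ r ∈ Finset.range m, h r * (1 / m * 1)) = 1 / m * ∑ r ∈ Finset.range m, h r := by
    rw [Finset.mul_sum]
    exact Finset.sum_congr rfl fun r _ => by ring
  rw [hval] at hlim
  refine hlim.congr' ?_
  filter_upwards [hpos] with i hi
  have hsum := summable_exp_neg_mul_int_sq hi
  have hsum' : Summable fun k : ℤ => h k * cexp (-Real.pi * w i * (k : ℂ) ^ 2) := by
    obtain ⟨C, hC⟩ : ∃ C, ∀ k : ℤ, ‖h k‖ ≤ C := by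
      refine ⟨∑ r ∈ Finset.range m, ‖h r‖, fun k => ?_⟩
      have hk : h k = h ((k % m).toNat : ℤ) := by
        have h0 : 0 ≤ k % m := Int.emod_nonneg _ (by exact_mod_cast hm.ne')
        rw [Int.toNat_of_nonneg h0]
        conv_lhs => rw [← Int.mul_ediv_add_emod k m]
        exact hper _ _
      rw [hk]
      refine Finset.single_le_sum (f := fun r : ℕ => ‖h r‖) (fun _ _ => norm_nonneg _) ?_
      have := Int.emod_lt_of_pos k (show (0 : ℤ) < m by exact_mod_cast hm)
      simp only [Finset.mem_range]
      omega
    refine Summable.of_norm_bounded (hsum.norm.mul_left C) fun k => ?_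
    rw [norm_mul]
    exact mul_le_mul_of_nonneg_right (hC k) (norm_nonneg _)
  rw [← (Int.divModEquiv m).symm.tsum_eq]
  rw [← (Int.divModEquiv m).symm.summable_iff] at hsum'
  rw [← (Equiv.prodComm (Fin m) ℤ).tsum_eq]
  rw [← (Equiv.prodComm _ _).summable_iff] at hsum'
  refine Eq.trans ?_ (congrArg _ hsum'.tsum_prod.symm)
  rw [tsum_fintype, Finset.sum_range, Finset.mul_sum]
  refine Finset.sum_congr rfl fun r _ => ?_
  rw [← cpow_half_mul_tsum_gaussian_residue hi hm, ← mul_assoc, mul_comm (h _), mul_assoc,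
    ← tsum_mul_left]
  congr 1
  refine tsum_congr fun k => ?_
  simp only [Function.comp, Equiv.prodComm_apply, Prod.swap, Int.divModEquiv, Equiv.coe_fn_symm_mk]
  rw [mul_comm k, add_comm, hper]
  push_cast
  ring_nf

open Filter Topology in
/-- Reciprocity for quadratic Gauss sums (Landsberg–Schaar). -/
theorem quadSum_reciprocity {a c : ℕ} (ha : 0 < a) (hc : 0 < c) (hac : Even (a * c)) :
    (-I * (a / c : ℝ)) ^ (1 / 2 : ℂ) * quadSum a c = quadSum (-c) a := by
  have haR : (0 : ℝ) < a := by exact_mod_cast ha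
  have hcR : (0 : ℝ) < c := by exact_mod_cast hc
  have ha0 : (a : ℂ) ≠ 0 := by exact_mod_cast ha.ne'
  have hc0 : (c : ℂ) ≠ 0 := by exact_mod_cast hc.ne'
  obtain ⟨e, he⟩ := hac
  have heC : (a : ℂ) * c = e + e := by exact_mod_cast he
  set A : ℝ → ℂ := fun ε => ε + -I * (a / c : ℝ) with hA
  set w : ℝ → ℂ := fun ε => (ε : ℂ) * ((c : ℂ) / (I * (a * A ε))) with hw
  have hper1 : ∀ k j : ℤ, cexp (Real.pi * I * a * ((c * k + j : ℤ) : ℂ) ^ 2 / c) =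
      cexp (Real.pi * I * a * (j : ℂ) ^ 2 / c) := by
    intro k j
    rw [Complex.exp_eq_exp_iff_exists_int]
    refine ⟨e * k ^ 2 + a * k * j, ?_⟩
    push_cast
    field_simp
    linear_combination c * (k : ℂ) ^ 2 * heC
  have hper2 : ∀ k j : ℤ, cexp (Real.pi * I * (-c : ℤ) * ((a * k + j : ℤ) : ℂ) ^ 2 / a) =
      cexp (Real.pi * I * (-c : ℤ) * (j : ℂ) ^ 2 / a) := by
    intro k j
    rw [Complex.exp_eq_exp_iff_exists_int]
    refine ⟨-(e * k ^ 2 + c * k * j), ?_⟩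
    push_cast
    field_simp
    linear_combination -a * (k : ℂ) ^ 2 * heC
  have hAre : ∀ ε, (A ε).re = ε := by intro ε; simp [hA]
  have hA0 : ∀ ε, 0 < ε → A ε ≠ 0 := by
    intro ε hε h
    have := hAre ε
    rw [h] at this
    simp at this
    exact hε.ne this
  have hl : Tendsto (fun ε : ℝ => (((ε : ℂ))⁻¹).re) (𝓝[>] 0) atTop := by
    refine tendsto_inv_nhdsGT_zero.congr fun ε => ?_
    rw [← ofReal_inv, ofReal_re]
  have hwinv : ∀ ε : ℝ, 0 < ε → (w ε)⁻¹ = ((ε⁻¹ * (a / c) ^ 2 : ℝ) : ℂ) + I * (a / c : ℝ) := by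
    intro ε hε
    have h1 := hA0 ε hε
    have hε0 : (ε : ℂ) ≠ 0 := by exact_mod_cast hε.ne'
    simp only [hw, hA]
    push_cast
    field_simp
    linear_combination (-(a : ℂ)) * I_sq
  have hlw : Tendsto (fun ε : ℝ => ((w ε)⁻¹).re) (𝓝[>] 0) atTop := by
    have hpos : 0 < (a / c : ℝ) ^ 2 := by positivity
    refine (tendsto_inv_nhdsGT_zero.atTop_mul_const hpos).congr' ?_
    filter_upwards [self_mem_nhdsWithin] with ε hε
    rw [hwinv ε hε]
    simp [-ofReal_pow, -ofReal_mul, -ofReal_div]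
  have lim1 := tendsto_cpow_half_mul_tsum_gaussian hl hc
    (fun k => cexp (Real.pi * I * a * (k : ℂ) ^ 2 / c)) hper1
  have lim2 := tendsto_cpow_half_mul_tsum_gaussian hlw ha
    (fun k => cexp (Real.pi * I * (-c : ℤ) * (k : ℂ) ^ 2 / a)) hper2
  have limA : Tendsto (fun ε => (A ε) ^ (1 / 2 : ℂ)) (𝓝[>] 0)
      (𝓝 ((-I * (a / c : ℝ)) ^ (1 / 2 : ℂ))) := by
    have hcont : Continuous A := by fun_prop
    have h0 : Tendsto A (𝓝[>] 0) (𝓝 (-I * (a / c : ℝ))) := by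
      have := hcont.tendsto 0
      simp only [hA, ofReal_zero, zero_add] at this
      exact this.mono_left nhdsWithin_le_nhds
    refine h0.cpow tendsto_const_nhds (Or.inr ?_)
    simp [ha.ne', hc.ne']
  have limq : Tendsto (fun ε => ((c : ℂ) / (I * (a * A ε))) ^ (1 / 2 : ℂ)) (𝓝[>] 0)
      (𝓝 (c / a)) := by
    have hne : I * (a * (-I * (a / c : ℝ))) ≠ 0 := by simp [ha.ne', hc.ne']
    have h0 : Tendsto (fun ε => (c : ℂ) / (I * (a * A ε))) (𝓝[>] 0)
        (𝓝 (c / (I * (a * (-I * (a / c : ℝ)))))) := by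
      have hcont : Continuous A := by fun_prop
      have := hcont.tendsto 0
      simp only [hA, ofReal_zero, zero_add] at this
      exact Tendsto.div tendsto_const_nhds ((this.mono_left nhdsWithin_le_nhds).const_mul _
        |>.const_mul _) hne
    have hval : (c : ℂ) / (I * (a * (-I * (a / c : ℝ)))) = (1 : ℂ) * (c / a : ℝ) ^ 2 := by
      push_cast
      field_simp
      linear_combination -I_sq
    rw [hval] at h0
    have h1 := h0.cpow (tendsto_const_nhds (x := (1 / 2 : ℂ))) (Or.inl (by
      have : (0 : ℝ) < (c / a) ^ 2 := by positivity
      rw [one_mul, ← ofReal_pow]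
      exact this))
    convert h1 using 2
    rw [one_mul, ← ofReal_pow, show (1 / 2 : ℂ) = ((1 / 2 : ℝ) : ℂ) by push_cast; rfl,
      ← ofReal_cpow (by positivity), ← Real.sqrt_eq_rpow, Real.sqrt_sq (by positivity)]
    push_cast; rfl
  have heq : ∀ᶠ ε : ℝ in 𝓝[>] 0,
      (A ε) ^ (1 / 2 : ℂ) * ((c : ℂ) / (I * (a * A ε))) ^ (1 / 2 : ℂ) * ((ε : ℂ) ^ (1 / 2 : ℂ) *
        ∑' k : ℤ, cexp (Real.pi * I * a * (k : ℂ) ^ 2 / c) * cexp (-Real.pi * ε * (k : ℂ) ^ 2)) =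
      (w ε) ^ (1 / 2 : ℂ) * ∑' k : ℤ, cexp (Real.pi * I * (-c : ℤ) * (k : ℂ) ^ 2 / a) *
        cexp (-Real.pi * w ε * (k : ℂ) ^ 2) := by
    filter_upwards [self_mem_nhdsWithin] with ε hε
    have hε : 0 < ε := hε
    have h1 := hA0 ε hε
    have key := Complex.tsum_exp_neg_mul_int_sq (a := A ε) (by rw [hAre]; exact hε)
    have t1 : ∀ k : ℤ, cexp (Real.pi * I * a * (k : ℂ) ^ 2 / c) *
        cexp (-Real.pi * ε * (k : ℂ) ^ 2) = cexp (-Real.pi * A ε * (k : ℂ) ^ 2) := by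
      intro k
      rw [← Complex.exp_add]
      congr 1
      simp only [hA]
      push_cast
      ring
    have t2 : ∀ k : ℤ, cexp (Real.pi * I * (-c : ℤ) * (k : ℂ) ^ 2 / a) *
        cexp (-Real.pi * w ε * (k : ℂ) ^ 2) = cexp (-Real.pi / A ε * (k : ℂ) ^ 2) := by
      intro k
      have : 1 / A ε = w ε + I * c / a := by
        simp only [hw]
        field_simp
        simp only [hA]
        push_cast
        field_simp
        linear_combination (-(ε : ℂ) * c + I * a) * I_sq
      rw [← Complex.exp_add, neg_div, div_eq_mul_one_div (Real.pi : ℂ), this]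
      congr 1
      push_cast
      ring
    simp_rw [t1, t2]
    rw [key, ofReal_mul_cpow_of_pos hε (by simp [ha.ne', hc.ne', h1])]
    have hne : (A ε) ^ (1 / 2 : ℂ) ≠ 0 := by simp [cpow_eq_zero_iff, h1]
    field_simp
  have hfin := tendsto_nhds_unique (((limA.mul limq).mul lim1).congr' heq) lim2
  have hsimp : ∀ X S T : ℂ, X * (c / a) * (1 / c * S) = 1 / a * T → X * S = T := by
    intro X S T h
    field_simp at h
    exact h
  have := hsimp _ _ _ hfin
  simpa only [quadSum, Int.cast_natCast] using this

open ComplexConjugate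

theorem quadSum_add_two_mul (a : ℤ) (c : ℕ) : quadSum (a + 2 * c) c = quadSum a c := by
  refine Finset.sum_congr rfl fun k hk => ?_
  have hc : (c : ℂ) ≠ 0 := by
    have := Finset.mem_range.1 hk
    exact_mod_cast (by omega : c ≠ 0)
  rw [Complex.exp_eq_exp_iff_exists_int]
  refine ⟨k ^ 2, ?_⟩
  push_cast
  field_simp

theorem quadSum_neg (a : ℤ) (c : ℕ) : quadSum (-a) c = conj (quadSum a c) := by
  simp only [quadSum, map_sum, ← Complex.exp_conj]
  refine Finset.sum_congr rfl fun k _ => ?_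
  congr 1
  simp
  
theorem neg_one_pow_eq_exp (k : ℕ) : ((-1 : ℂ)) ^ k = cexp (Real.pi * I * k) := by
  rw [← exp_pi_mul_I, ← Complex.exp_nat_mul]
  ring_nf

theorem jacobiSym_right_of_four_mul_dvd_sub {k a b : ℕ} (ha : Odd a) (hb : Odd b)
    (h : a % (4 * k) = b % (4 * k)) : jacobiSym k a = jacobiSym k b := by
  rw [jacobiSym.mod_right _ ha, jacobiSym.mod_right _ hb]
  simp only [Int.natAbs_natCast, h]

theorem jacobiSym_right_of_four_mul_dvd_add {k a b : ℕ} (hk : 0 < k) (ha : Odd a) (hb : Odd b)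
    (h : 4 * k ∣ a + b) : jacobiSym k a = jacobiSym k b := by
  induction k using Nat.strong_induction_on with
  | _ k ih =>
    rcases Nat.even_or_odd' k with ⟨j, rfl | rfl⟩
    · have h8 : (b : ZMod 8) = -a := by
        have : ((a + b : ℕ) : ZMod 8) = 0 := by
          rw [ZMod.natCast_eq_zero_iff]
          exact dvd_trans ⟨j, by ring⟩ h
        push_cast at this
        linear_combination this
      have hχ : ∀ x : ZMod 8, ZMod.χ₈ (-x) = ZMod.χ₈ x := by decide
      push_cast
      rw [jacobiSym.mul_left, jacobiSym.mul_left, jacobiSym.at_two ha, jacobiSym.at_two hb,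
        ih j (by omega) (by omega) (dvd_trans ⟨2, by ring⟩ h), h8, hχ]
    · have hk' : Odd (2 * j + 1) := ⟨j, rfl⟩
      rw [jacobiSym.quadratic_reciprocity hk' ha, jacobiSym.quadratic_reciprocity hk' hb]
      have hbk : jacobiSym b (2 * j + 1) = jacobiSym (-a) (2 * j + 1) := by
        apply jacobiSym.mod_left'
        apply Int.ModEq.symm
        rw [Int.modEq_iff_dvd]
        have : ((2 * j + 1 : ℕ) : ℤ) ∣ ((a + b : ℕ) : ℤ) := by
          exact_mod_cast dvd_trans ⟨4, by ring⟩ h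
        push_cast at this ⊢
        convert this using 1
        ring
      rw [hbk, jacobiSym.neg _ hk', ZMod.χ₄_eq_neg_one_pow (Nat.odd_iff.1 hk'), ← mul_assoc,
        ← pow_add]
      congr 1
      have h4 : 4 ∣ a + b := dvd_trans ⟨2 * j + 1, rfl⟩ h
      obtain ⟨x, rfl⟩ := ha
      obtain ⟨y, rfl⟩ := hb
      have e1 : (2 * j + 1) / 2 = j := by omega
      have e2 : (2 * x + 1) / 2 = x := by omega
      have e3 : (2 * y + 1) / 2 = y := by omega
      rw [e1, e2, e3]
      obtain ⟨t, ht⟩ : ∃ t, x + y + 1 = 2 * t := ⟨(x + y + 1) / 2, by omega⟩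
      rw [show j * y + j = j * (y + 1) by ring, pow_mul, pow_mul]
      rcases neg_one_pow_eq_or ℤ j with hj | hj <;> rw [hj]
      · simp
      · rcases Nat.even_or_odd x with hx | hx
        · rw [hx.neg_one_pow, Even.neg_one_pow (by grind)]
        · rw [hx.neg_one_pow, Odd.neg_one_pow (by grind)]

theorem jacobiSym_four_mul_left (k : ℕ) {x : ℕ} (hx : Odd x) :
    jacobiSym ((4 * k : ℕ) : ℤ) x = jacobiSym k x := by
  push_cast
  rw [jacobiSym.mul_left, jacobiSym.at_four hx, one_mul]

theorem jacobiSym_right_add_two_mul {a c : ℕ} (ha : Odd a) (hc : Even c) :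
    jacobiSym c (a + 2 * c) = (-1) ^ (c / 2) * jacobiSym c a := by
  have ha' : Odd (a + 2 * c) := by grind
  obtain ⟨m, rfl⟩ := hc.two_dvd
  rw [Nat.mul_div_cancel_left _ two_pos]
  rcases Nat.even_or_odd m with hm | hm
  · obtain ⟨k, rfl⟩ := hm.two_dvd
    rw [hm.neg_one_pow, one_mul, show 2 * (2 * k) = 4 * k by ring,
      jacobiSym_four_mul_left k ha, jacobiSym_four_mul_left k (by grind)]
    exact jacobiSym_right_of_four_mul_dvd_sub (by grind) ha (by
      simp [show a + 2 * (4 * k) = a + 4 * k * 2 by ring])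
  · have hχ : ∀ x : ZMod 8, ZMod.χ₈ (x + 4) = - ZMod.χ₈ x := by decide
    have h8 : ((a + 2 * (2 * m) : ℕ) : ZMod 8) = a + 4 := by
      obtain ⟨j, rfl⟩ := hm
      have : (8 : ZMod 8) = 0 := by decide
      push_cast
      linear_combination j * this
    rw [hm.neg_one_pow]
    push_cast
    rw [jacobiSym.mul_left, jacobiSym.mul_left, jacobiSym.at_two ha, jacobiSym.at_two ha', h8, hχ,
      jacobiSym_right_of_four_mul_dvd_sub ha' ha (by simp [show a + 2 * (2 * m) = a + 4 * m by ring])]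
    ring

theorem jacobiSym_right_two_mul_sub {a b c : ℕ} (ha : Odd a) (hc : Even c) (h : a + b = 2 * c) :
    jacobiSym c b = (-1) ^ (c / 2) * jacobiSym c a := by
  have hb : Odd b := by grind
  obtain ⟨m, rfl⟩ := hc.two_dvd
  have hm0 : 0 < m := by grind
  rw [Nat.mul_div_cancel_left _ two_pos]
  rcases Nat.even_or_odd m with hm | hm
  · obtain ⟨k, rfl⟩ := hm.two_dvd
    rw [hm.neg_one_pow, one_mul, show 2 * (2 * k) = 4 * k by ring,
      jacobiSym_four_mul_left k ha, jacobiSym_four_mul_left k hb]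
    exact (jacobiSym_right_of_four_mul_dvd_add (by omega) ha hb ⟨2, by omega⟩).symm
  · have hχ : ∀ x : ZMod 8, ZMod.χ₈ (4 - x) = - ZMod.χ₈ x := by decide
    have h8 : (b : ZMod 8) = 4 - a := by
      obtain ⟨j, rfl⟩ := hm
      have h0 : (8 : ZMod 8) = 0 := by decide
      have := congrArg (Nat.cast : ℕ → ZMod 8) h
      push_cast at this
      linear_combination this + j * h0
    rw [hm.neg_one_pow]
    push_cast
    rw [jacobiSym.mul_left, jacobiSym.mul_left, jacobiSym.at_two ha, jacobiSym.at_two hb, h8, hχ,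
      jacobiSym_right_of_four_mul_dvd_add hm0 ha hb ⟨1, by omega⟩]
    ring

theorem lamb_of_odd {a c : ℕ} (hc : Odd c) (ha : Even a) :
    lamb a c = cexp (Real.pi * I * ((1 - (c : ℂ)) / 2) / 2) * (jacobiSym a c : ℂ) :=
  if_pos ⟨hc, ha⟩

theorem lamb_of_even {a c : ℕ} (hc : Even c) (ha : Odd a) :
    lamb a c = cexp (Real.pi * I * ((a : ℂ) / 2) / 2) * (jacobiSym c a : ℂ) := by
  rw [lamb, if_neg (by grind), if_pos ⟨ha, hc⟩]

theorem exp_pi_mul_even {c : ℕ} (hc : Even c) : cexp (Real.pi * I * c / 2) = (-1) ^ (c / 2) := by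
  obtain ⟨m, rfl⟩ := hc.two_dvd
  rw [Nat.mul_div_cancel_left _ two_pos, neg_one_pow_eq_exp]
  congr 1
  push_cast
  ring

theorem neg_one_pow_mul_self (m : ℕ) : ((-1 : ℂ)) ^ m * (-1) ^ m = 1 := by
  rw [← mul_pow]; simp

theorem lamb_add_two_mul {a c : ℕ} (h : Even a ↔ Odd c) : lamb (a + 2 * c) c = lamb a c := by
  rcases Nat.even_or_odd c with hc | hc
  · have ha : Odd a := by grind
    rw [lamb_of_even hc ha, lamb_of_even hc (by grind), jacobiSym_right_add_two_mul ha hc]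
    have : cexp (Real.pi * I * (((a + 2 * c : ℕ) : ℂ) / 2) / 2) =
        cexp (Real.pi * I * ((a : ℂ) / 2) / 2) * (-1) ^ (c / 2) := by
      rw [← exp_pi_mul_even hc, ← Complex.exp_add]
      congr 1
      push_cast
      ring
    rw [this]
    push_cast
    linear_combination cexp (Real.pi * I * ((a : ℂ) / 2) / 2) * (jacobiSym c a : ℂ) *
      neg_one_pow_mul_self (c / 2)
  · have ha : Even a := by grind
    rw [lamb_of_odd hc ha, lamb_of_odd hc (by grind)]
    congr 2
    apply jacobiSym.mod_left'
    push_cast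
    simp

theorem lamb_two_mul_sub {a b c : ℕ} (h : Even a ↔ Odd c) (hab : a + b = 2 * c) :
    lamb b c = conj (lamb a c) := by
  have h2 : (starRingEnd ℂ) 2 = 2 := map_ofNat _ 2
  rcases Nat.even_or_odd c with hc | hc
  · have ha : Odd a := by grind
    rw [lamb_of_even hc ha, lamb_of_even hc (by grind), jacobiSym_right_two_mul_sub ha hc hab,
      map_mul, ← Complex.exp_conj]
    have hb : (b : ℂ) = 2 * c - a := by
      have := congrArg (Nat.cast : ℕ → ℂ) hab
      push_cast at this
      linear_combination this
    have : cexp (Real.pi * I * ((b : ℂ) / 2) / 2) =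
        cexp (conj (Real.pi * I * ((a : ℂ) / 2) / 2)) * (-1) ^ (c / 2) := by
      rw [← exp_pi_mul_even hc, ← Complex.exp_add, hb]
      congr 1
      simp [h2]
      ring
    rw [this]
    simp only [map_intCast]
    push_cast
    linear_combination cexp (conj (Real.pi * I * ((a : ℂ) / 2) / 2)) * (jacobiSym c a : ℂ) *
      neg_one_pow_mul_self (c / 2)
  · have ha : Even a := by grind
    rw [lamb_of_odd hc ha, lamb_of_odd hc (by grind)]
    have hJ : jacobiSym b c = (-1) ^ (c / 2) * jacobiSym a c := by
      rw [← ZMod.χ₄_eq_neg_one_pow (Nat.odd_iff.1 hc), ← jacobiSym.neg _ hc]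
      apply jacobiSym.mod_left'
      have : (b : ℤ) = -a + c * 2 := by omega
      rw [this]
      simp
    rw [hJ, map_mul, ← Complex.exp_conj]
    obtain ⟨k, rfl⟩ := hc
    have : cexp (conj (Real.pi * I * ((1 - ((2 * k + 1 : ℕ) : ℂ)) / 2) / 2)) =
        cexp (Real.pi * I * ((1 - ((2 * k + 1 : ℕ) : ℂ)) / 2) / 2) * (-1) ^ k := by
      rw [neg_one_pow_eq_exp, ← Complex.exp_add]
      congr 1
      simp [h2]
      ring
    rw [this, show (2 * k + 1) / 2 = k by omega]
    simp only [map_intCast]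
    push_cast
    ring

theorem lamb_swap {a c : ℕ} (h : Even a ↔ Odd c) :
    lamb a c = cexp (Real.pi * I / 4) * conj (lamb c a) := by
  have h2 : (starRingEnd ℂ) 2 = 2 := map_ofNat _ 2
  rcases Nat.even_or_odd c with hc | hc
  · have ha : Odd a := by grind
    rw [lamb_of_even hc ha, lamb_of_odd ha hc, map_mul, ← Complex.exp_conj, ← mul_assoc,
      ← Complex.exp_add]
    simp only [map_intCast]
    congr 2
    simp [h2]
    ring
  · have ha : Even a := by grind
    rw [lamb_of_odd hc ha, lamb_of_even ha hc, map_mul, ← Complex.exp_conj, ← mul_assoc,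
      ← Complex.exp_add]
    simp only [map_intCast]
    congr 2
    simp [h2]
    ring

theorem neg_I_mul_cpow_half {r : ℝ} (hr : 0 < r) :
    (-I * r) ^ (1 / 2 : ℂ) = Real.sqrt r * cexp (-(Real.pi * I / 4)) := by
  rw [mul_comm, ofReal_mul_cpow_of_pos hr (by simp), Real.sqrt_eq_rpow, ofReal_cpow hr.le]
  congr 1
  · norm_num
  · rw [cpow_def_of_ne_zero (by simp), log_neg_I]
    congr 1
    ring

theorem quadSum_eq_of_swap {a c : ℕ} (ha : 0 < a) (hc : 0 < c) (h : Even a ↔ Odd c)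
    (hs : quadSum c a = Real.sqrt a * lamb c a) : quadSum a c = Real.sqrt c * lamb a c := by
  have haR : (0 : ℝ) < a := by exact_mod_cast ha
  have hcR : (0 : ℝ) < c := by exact_mod_cast hc
  have key := quadSum_reciprocity ha hc (by grind)
  rw [neg_I_mul_cpow_half (by positivity), quadSum_neg, hs, map_mul, conj_ofReal,
    Real.sqrt_div haR.le] at key
  rw [lamb_swap h]
  have h1 : (Real.sqrt a : ℂ) ≠ 0 := by
    rw [ofReal_ne_zero]; positivity
  have h2 : (Real.sqrt c : ℂ) ≠ 0 := by
    rw [ofReal_ne_zero]; positivity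
  have h3 : cexp (Real.pi * I / 4) * cexp (-(Real.pi * I / 4)) = 1 := by
    rw [← Complex.exp_add]; simp
  push_cast at key
  have key2 : cexp (-(Real.pi * I / 4)) * quadSum a c = Real.sqrt c * conj (lamb c a) := by
    field_simp at key
    linear_combination key
  linear_combination cexp (Real.pi * I / 4) * key2 - quadSum a c * h3

theorem lamb_add_two_mul_mul {a c : ℕ} (h : Even a ↔ Odd c) (j : ℕ) :
    lamb (a + 2 * c * j) c = lamb a c := by
  induction j with
  | zero => simp
  | succ j ih =>
    rw [← ih, show a + 2 * c * (j + 1) = (a + 2 * c * j) + 2 * c by ring]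
    exact lamb_add_two_mul (by grind)

theorem quadSum_add_two_mul_mul (a : ℤ) (c : ℕ) (j : ℕ) :
    quadSum (a + 2 * c * j) c = quadSum a c := by
  induction j with
  | zero => simp
  | succ j ih =>
    rw [← ih, ← quadSum_add_two_mul (a + 2 * c * j)]
    push_cast
    ring_nf

/-- The theta multiplier is a normalised quadratic Gauss sum. -/
theorem quadSum_eq_sqrt_mul_lamb {a c : ℕ} (hc : 0 < c) (h : Even a ↔ Odd c)
    (hcop : a.Coprime c) : quadSum a c = Real.sqrt c * lamb a c := by
  induction c using Nat.strong_induction_on generalizing a with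
  | _ c ih =>
    rcases Nat.lt_or_ge 1 c with hc1 | hc1
    · have step : ∀ b : ℕ, 0 < b → b < c → (Even b ↔ Odd c) → b.Coprime c →
          quadSum b c = Real.sqrt c * lamb b c := fun b hb0 hbc hbp hb =>
        quadSum_eq_of_swap hb0 hc hbp (ih b hbc hb0 (by grind) hb.symm)
      obtain ⟨b, hb, j, rfl⟩ : ∃ b < 2 * c, ∃ j, a = b + 2 * c * j :=
        ⟨a % (2 * c), Nat.mod_lt _ (by omega), a / (2 * c), (Nat.mod_add_div _ _).symm⟩
      have hbp : Even b ↔ Odd c := by grind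
      have hbc : b.Coprime c := by
        have := hcop
        rwa [show b + 2 * c * j = b + c * (2 * j) by ring, Nat.coprime_add_mul_left_left] at this
      rw [lamb_add_two_mul_mul hbp]
      push_cast
      rw [quadSum_add_two_mul_mul]
      have hb0 : b ≠ 0 := by
        rintro rfl
        simp at hbc
        omega
      rcases Nat.lt_trichotomy b c with hlt | rfl | hgt
      · exact step b (by omega) hlt hbp hbc
      · simp at hbc
        omega
      · obtain ⟨e, he⟩ : ∃ e, b + e = 2 * c := ⟨2 * c - b, by omega⟩
        have hec : e.Coprime c := by
          have h1 : (b + e).gcd c = c := by rw [he]; simp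
          rw [Nat.coprime_comm, Nat.coprime_iff_gcd_eq_one]
          have hd1 : c.gcd e ∣ b := by
            have : c.gcd e ∣ b + e := by rw [he]; exact (Nat.gcd_dvd_left _ _).mul_left _
            exact (Nat.dvd_add_left (Nat.gcd_dvd_right _ _)).1 this
          have := Nat.dvd_gcd hd1 (Nat.gcd_dvd_left c e)
          rw [Nat.coprime_iff_gcd_eq_one.1 hbc] at this
          exact Nat.dvd_one.1 this
        have he' := step e (by omega) (by omega) (by grind) hec
        have hb' : (b : ℤ) = -e + 2 * c := by omega
        rw [hb', quadSum_add_two_mul, quadSum_neg, he', map_mul, conj_ofReal,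
          lamb_two_mul_sub (b := b) (by grind : Even e ↔ Odd c) (by omega)]
    · obtain rfl : c = 1 := by omega
      simp [quadSum, lamb_of_odd odd_one (h.2 odd_one)]

open Finset in
theorem sum_range_mul_of_periodic {M : Type*} [AddCommMonoid M] {F : ℕ → M} {m : ℕ}
    (hF : ∀ k, F (k + m) = F k) (q : ℕ) :
    ∑ k ∈ range (m * q), F k = q • ∑ k ∈ range m, F k := by
  induction q with
  | zero => simp
  | succ q ih =>
    rw [Nat.mul_succ, sum_range_add, ih, succ_nsmul]
    congr 1
    refine sum_congr rfl fun k _ => ?_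
    clear ih
    induction q with
    | zero => simp
    | succ q ih => rw [← ih, ← hF (m * q + k)]; congr 1; ring

open Finset in
theorem sum_Icc_one_eq_sum_range {M : Type*} [AddCommMonoid M] {F : ℕ → M} {m : ℕ}
    (hF : F m = F 0) : ∑ k ∈ Icc 1 m, F k = ∑ k ∈ range m, F k := by
  cases m with
  | zero => simp
  | succ m =>
    have h : Icc 1 (m + 1) = Ico 1 (m + 2) := by ext; simp; omega
    rw [h, sum_Ico_succ_top (by omega), hF, add_comm, ← Nat.Ico_zero_eq_range,
      sum_eq_sum_Ico_succ_bot m.succ_pos]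

open Finset in
theorem sum_range_eq_sum_divisors_coprime {M : Type*} [AddCommMonoid M] (F : ℕ → M) {m : ℕ}
    (hm : 0 < m) :
    ∑ a ∈ range m, F a =
      ∑ d ∈ m.divisors, ∑ a ∈ range d with a.Coprime d, F (a * (m / d)) := by
  rw [Finset.sum_sigma']
  symm
  refine Finset.sum_bij (fun x _ => x.2 * (m / x.1)) ?_ ?_ ?_ ?_
  · rintro ⟨d, a⟩ h
    simp only [mem_sigma, Nat.mem_divisors, mem_filter, mem_range] at h ⊢
    obtain ⟨⟨⟨e, rfl⟩, -⟩, had, -⟩ := h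
    have hd : 0 < d := by omega
    have he : 0 < e := by
      rcases Nat.eq_zero_or_pos e with rfl | h
      · simp at hm
      · exact h
    rw [Nat.mul_div_cancel_left _ hd]
    exact Nat.mul_lt_mul_of_pos_right had he
  · rintro ⟨d, a⟩ h ⟨d', a'⟩ h' heq
    simp only [mem_sigma, Nat.mem_divisors, mem_filter, mem_range] at h h' heq
    obtain ⟨⟨hd, -⟩, had, hc⟩ := h
    obtain ⟨⟨hd', -⟩, had', hc'⟩ := h'
    have key : ∀ {d a : ℕ}, d ∣ m → a.Coprime d → (a * (m / d)).gcd m = m / d := by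
      intro d a hd hc
      obtain ⟨e, rfl⟩ := hd
      have hd0 : 0 < d := Nat.pos_of_mul_pos_right hm
      rw [Nat.mul_div_cancel_left _ hd0, Nat.gcd_mul_right, hc, one_mul]
    have h1 : m / d = m / d' := by rw [← key hd hc, ← key hd' hc', heq]
    have h2 : d = d' := by
      rw [← Nat.div_div_self hd hm.ne', ← Nat.div_div_self hd' hm.ne', h1]
    subst h2
    have hpos : 0 < m / d := Nat.div_pos (Nat.le_of_dvd hm hd) (by omega)
    rw [Nat.eq_of_mul_eq_mul_right hpos heq]
  · intro a ha
    have ha := mem_range.1 ha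
    have hg : 0 < a.gcd m := Nat.gcd_pos_of_pos_right _ hm
    refine ⟨⟨m / a.gcd m, a / a.gcd m⟩, ?_, ?_⟩
    · simp only [mem_sigma, Nat.mem_divisors, mem_filter, mem_range]
      refine ⟨⟨Nat.div_dvd_of_dvd (Nat.gcd_dvd_right _ _), hm.ne'⟩, ?_,
        Nat.coprime_div_gcd_div_gcd hg⟩
      exact Nat.div_lt_div_of_lt_of_dvd (Nat.gcd_dvd_right _ _) ha
    · simp only
      rw [Nat.div_div_self (Nat.gcd_dvd_right _ _) hm.ne', Nat.div_mul_cancel (Nat.gcd_dvd_left _ _)]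
  · simp

open Finset in
/-- The number of square roots of `n` modulo `m`. -/
def rootCount (n : ℤ) (m : ℕ) : ℕ := #{k ∈ range m | (m : ℤ) ∣ ((k : ℕ) : ℤ) ^ 2 - n}

theorem sum_range_exp_eq_ite {m : ℕ} (hm : 0 < m) (t : ℤ) :
    ∑ a ∈ Finset.range m, cexp (2 * Real.pi * I * a * t / m) =
      if (m : ℤ) ∣ t then (m : ℂ) else 0 := by
  have hmC : (m : ℂ) ≠ 0 := by exact_mod_cast hm.ne'
  have h2 : (2 * Real.pi * I : ℂ) ≠ 0 := two_pi_I_ne_zero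
  have h : ∀ a : ℕ, cexp (2 * Real.pi * I * a * t / m) = cexp (2 * Real.pi * I * t / m) ^ a := by
    intro a
    rw [← Complex.exp_nat_mul]
    ring_nf
  simp_rw [h]
  have h1 : cexp (2 * Real.pi * I * t / m) = 1 ↔ (m : ℤ) ∣ t := by
    rw [Complex.exp_eq_one_iff]
    constructor
    · rintro ⟨j, hj⟩
      refine ⟨j, ?_⟩
      have : (t : ℂ) = m * j := by
        field_simp at hj
        linear_combination hj
      exact_mod_cast this
    · rintro ⟨j, rfl⟩
      refine ⟨j, ?_⟩
      push_cast
      field_simp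
  split_ifs with hd
  · rw [h1.2 hd]; simp
  · have hne := mt h1.1 hd
    rw [geom_sum_eq hne, ← h, div_eq_zero_iff]
    left
    rw [sub_eq_zero, Complex.exp_eq_one_iff]
    exact ⟨t, by field_simp⟩

open Finset in
/-- The complete quadratic exponential sum over the reduced residues modulo `m`. -/
def reducedGaussSum (n : ℤ) (m : ℕ) : ℂ :=
  ∑ a ∈ range m with a.Coprime m, quadSum (2 * a) m * cexp (-(2 * Real.pi * I * a * n / m))

theorem quadSum_mul_mul (a d e : ℕ) :
    quadSum (2 * (a * e)) (d * e) = e * quadSum (2 * a) d := by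
  rcases Nat.eq_zero_or_pos d with rfl | hd
  · simp [quadSum]
  rcases Nat.eq_zero_or_pos e with rfl | he
  · simp [quadSum]
  have hdC : (d : ℂ) ≠ 0 := by exact_mod_cast hd.ne'
  have heC : (e : ℂ) ≠ 0 := by exact_mod_cast he.ne'
  simp only [quadSum]
  rw [← nsmul_eq_mul (α := ℂ), ← sum_range_mul_of_periodic]
  · refine Finset.sum_congr rfl fun k _ => ?_
    congr 1
    push_cast
    field_simp
  · intro k
    rw [Complex.exp_eq_exp_iff_exists_int]
    refine ⟨2 * a * k + a * d, ?_⟩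
    push_cast
    field_simp
    ring

theorem sum_divisors_reducedGaussSum (n : ℤ) {m : ℕ} (hm : 0 < m) :
    ∑ d ∈ m.divisors, reducedGaussSum n d / d = rootCount n m := by
  have hmC : (m : ℂ) ≠ 0 := by exact_mod_cast hm.ne'
  have h1 : (m : ℂ) * rootCount n m = ∑ a ∈ Finset.range m,
      quadSum (2 * a) m * cexp (-(2 * Real.pi * I * a * n / m)) := by
    have : ∀ a ∈ Finset.range m, quadSum (2 * a) m * cexp (-(2 * Real.pi * I * a * n / m)) =
        ∑ k ∈ Finset.range m, cexp (2 * Real.pi * I * a * (((k : ℤ) ^ 2 - n : ℤ) : ℂ) / m) := by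
      intro a _
      rw [quadSum, Finset.sum_mul]
      refine Finset.sum_congr rfl fun k _ => ?_
      rw [← Complex.exp_add]
      congr 1
      push_cast
      ring
    rw [Finset.sum_congr rfl this, Finset.sum_comm]
    simp_rw [sum_range_exp_eq_ite hm]
    rw [← Finset.sum_filter, Finset.sum_const, rootCount, nsmul_eq_mul, mul_comm]
  rw [sum_range_eq_sum_divisors_coprime _ hm] at h1
  apply mul_left_cancel₀ hmC
  rw [h1, Finset.mul_sum]
  refine Finset.sum_congr rfl fun d hd => ?_
  obtain ⟨⟨e, rfl⟩, -⟩ := Nat.mem_divisors.1 hd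
  have hd0 : 0 < d := Nat.pos_of_mul_pos_right hm
  have hdC : (d : ℂ) ≠ 0 := by exact_mod_cast hd0.ne'
  have heC : (e : ℂ) ≠ 0 := by
    rintro h
    simp [h] at hmC
  rw [reducedGaussSum, Finset.sum_div, Finset.mul_sum]
  refine Finset.sum_congr rfl fun a _ => ?_
  rw [Nat.mul_div_cancel_left _ hd0]
  push_cast
  rw [quadSum_mul_mul, show 2 * Real.pi * I * (a * e) * n / (d * e) = 2 * Real.pi * I * a * n / d by
    field_simp]
  field_simp

theorem lamb_eq_zero {a c : ℕ} (h : ¬ ((Even a ↔ Odd c) ∧ a.Coprime c)) : lamb a c = 0 := by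
  by_cases hp : Even a ↔ Odd c
  · have hc : ¬ a.Coprime c := fun h' => h ⟨hp, h'⟩
    rcases Nat.even_or_odd c with hc' | hc'
    · have ha : Odd a := by grind
      have : NeZero a := ⟨by grind⟩
      rw [lamb_of_even hc' ha, jacobiSym.eq_zero_iff_not_coprime.2]
      · simp
      · simpa [Int.gcd_natCast_natCast, Nat.gcd_comm] using hc
    · have : NeZero c := ⟨by grind⟩
      rw [lamb_of_odd hc' (by grind), jacobiSym.eq_zero_iff_not_coprime.2]
      · simp
      · simpa [Int.gcd_natCast_natCast] using hc
  · rw [lamb, if_neg (by grind), if_neg (by grind)]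

theorem cpow_neg_half_mul_inv_sqrt {c : ℕ} (hc : 0 < c) :
    (c : ℂ) ^ (-(1 : ℂ) / 2) * (Real.sqrt c : ℂ)⁻¹ = (c : ℂ)⁻¹ := by
  have hcC : (c : ℂ) ≠ 0 := by exact_mod_cast hc.ne'
  have : (Real.sqrt c : ℂ) = (c : ℂ) ^ (1 / 2 : ℂ) := by
    rw [Real.sqrt_eq_rpow, ofReal_cpow (by positivity)]
    norm_num
  rw [this, ← cpow_neg, ← cpow_add _ _ hcC, ← cpow_neg_one]
  norm_num

theorem lamb_eq_quadSum {a c : ℕ} (hc : 0 < c) (h : Even a ↔ Odd c) (hcop : a.Coprime c) :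
    lamb a c = (Real.sqrt c : ℂ)⁻¹ * quadSum a c := by
  rw [quadSum_eq_sqrt_mul_lamb hc h hcop, ← mul_assoc, inv_mul_cancel₀, one_mul]
  rw [ofReal_ne_zero]
  positivity

open Finset in
theorem gaussG_of_odd {c : ℕ} (hc : Odd c) (n : ℤ) : gaussG c n = reducedGaussSum n c / c := by
  have hc0 : 0 < c := hc.pos
  have hcC : (c : ℂ) ≠ 0 := by exact_mod_cast hc0.ne'
  have h1 : ∑ a ∈ Icc 1 (2 * c), lamb a c * cexp (-Real.pi * I * n * a / c) =
      ∑ a ∈ range (2 * c), lamb a c * cexp (-Real.pi * I * n * a / c) := by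
    apply sum_Icc_one_eq_sum_range
    have : lamb (2 * c) c = lamb 0 c := by
      simpa using lamb_add_two_mul (a := 0) (c := c) (by simpa using hc)
    rw [this]
    congr 1
    rw [Complex.exp_eq_exp_iff_exists_int]
    refine ⟨-n, ?_⟩
    push_cast
    field_simp
    ring
  have h2 : ∑ a ∈ range (2 * c), lamb a c * cexp (-Real.pi * I * n * a / c) =
      ∑ a ∈ range c with a.Coprime c, lamb (2 * a) c * cexp (-(2 * Real.pi * I * a * n / c)) := by
    rw [Finset.sum_filter]
    symm
    refine Finset.sum_of_injOn (fun a => 2 * a) ?_ ?_ ?_ ?_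
    · intro a _ b _ h
      simpa using h
    · intro a ha
      simp only [coe_range, Set.mem_Iio] at ha ⊢
      omega
    · intro b hb hb'
      rw [lamb_eq_zero, zero_mul]
      rintro ⟨h, -⟩
      obtain ⟨a, rfl⟩ := (h.2 hc).two_dvd
      exact hb' ⟨a, by simp at hb ⊢; omega, rfl⟩
    · intro a _
      split_ifs with h
      · congr 2
        push_cast
        ring
      · rw [lamb_eq_zero, zero_mul]
        rintro ⟨-, h'⟩
        exact h h'.coprime_mul_left
  rw [gaussG, h1, h2, reducedGaussSum, Finset.mul_sum, Finset.sum_div]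
  refine Finset.sum_congr rfl fun a ha => ?_
  have hcop : (2 * a).Coprime c :=
    Nat.Coprime.mul_left (Nat.coprime_two_left.2 hc) (mem_filter.1 ha).2
  rw [lamb_eq_quadSum hc0 (by simpa using hc) hcop]
  push_cast
  rw [← mul_assoc, ← mul_assoc, cpow_neg_half_mul_inv_sqrt hc0]
  ring

theorem quadSum_two_mul_four_mul (a c : ℕ) :
    quadSum (2 * a) (4 * c) = 2 * quadSum a (2 * c) := by
  rcases Nat.eq_zero_or_pos c with rfl | hc
  · simp [quadSum]
  have hcC : (c : ℂ) ≠ 0 := by exact_mod_cast hc.ne'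
  have h2 : (2 : ℂ) = (2 : ℕ) := by norm_num
  rw [h2, show 4 * c = 2 * c * 2 by ring, quadSum, quadSum, ← nsmul_eq_mul,
    ← sum_range_mul_of_periodic]
  · refine Finset.sum_congr rfl fun k _ => ?_
    congr 1
    push_cast
    field_simp
  · intro k
    rw [Complex.exp_eq_exp_iff_exists_int]
    refine ⟨a * k + a * c, ?_⟩
    push_cast
    field_simp
    ring

open Finset in
theorem gaussG_two_mul {c : ℕ} (hc0 : 0 < c) (n : ℤ) :
    gaussG (2 * c) n = reducedGaussSum n (4 * c) / ((4 * c : ℕ) : ℂ) := by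
  have hcC : (c : ℂ) ≠ 0 := by exact_mod_cast hc0.ne'
  have hz : ∀ {a}, ¬ a.Coprime (4 * c) → lamb a (2 * c) = 0 := by
    intro a h
    refine lamb_eq_zero ?_
    rintro ⟨-, h'⟩
    refine h ?_
    rw [show 4 * c = 2 * (2 * c) by ring]
    exact h'.coprime_mul_right_right.mul_right h'
  have h1 : ∑ a ∈ Icc 1 (2 * (2 * c)),
      lamb a (2 * c) * cexp (-Real.pi * I * n * a / (2 * c : ℕ)) =
      ∑ a ∈ range (4 * c), lamb a (2 * c) * cexp (-Real.pi * I * n * a / (2 * c : ℕ)) := by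
    rw [show 2 * (2 * c) = 4 * c by ring]
    apply sum_Icc_one_eq_sum_range
    rw [hz (by simp), hz (by simp)]
    simp
  rw [gaussG, h1, reducedGaussSum, Finset.mul_sum, Finset.sum_div, Finset.sum_filter]
  refine Finset.sum_congr rfl fun a ha => ?_
  split_ifs with h
  · have hcop : a.Coprime (2 * c) := by
      rw [show 4 * c = 2 * (2 * c) by ring] at h
      exact h.coprime_mul_left_right
    have hodd : Odd a := Nat.coprime_two_right.1 hcop.coprime_mul_right_right
    rw [lamb_eq_quadSum (by omega) (by grind) hcop, ← mul_assoc, ← mul_assoc,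
      cpow_neg_half_mul_inv_sqrt (by omega), quadSum_two_mul_four_mul]
    have : -Real.pi * I * n * a / (2 * c : ℕ) = -(2 * Real.pi * I * a * n / (4 * c : ℕ)) := by
      push_cast
      field_simp
      ring
    rw [this]
    push_cast
    field_simp
    ring
  · rw [hz h]; simp

open Finset in
theorem rootCount_eq_card_zmod (n : ℤ) (m : ℕ) [NeZero m] :
    rootCount n m = #{x : ZMod m | x ^ 2 = n} := by
  rw [rootCount]
  refine Finset.card_bij (fun k _ => (k : ZMod m)) ?_ ?_ ?_
  · intro k hk
    have := (ZMod.intCast_zmod_eq_zero_iff_dvd _ m).2 (mem_filter.1 hk).2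
    push_cast at this
    simpa [sub_eq_zero] using this
  · intro a ha b hb h
    have ha := mem_range.1 (mem_filter.1 ha).1
    have hb := mem_range.1 (mem_filter.1 hb).1
    have := (ZMod.natCast_eq_natCast_iff' _ _ _).1 h
    rwa [Nat.mod_eq_of_lt ha, Nat.mod_eq_of_lt hb] at this
  · intro x hx
    refine ⟨x.val, ?_, ZMod.natCast_zmod_val x⟩
    rw [mem_filter, mem_range, ← ZMod.intCast_zmod_eq_zero_iff_dvd]
    refine ⟨ZMod.val_lt x, ?_⟩
    push_cast
    rw [ZMod.natCast_zmod_val, (mem_filter.1 hx).2, sub_self]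

theorem rootCount_one (n : ℤ) : rootCount n 1 = 1 := by
  simp [rootCount]

theorem rootCount_two (n : ℤ) : rootCount n 2 = 1 := by
  rcases Int.even_or_odd' n with ⟨k, rfl | rfl⟩
  · rw [rootCount, Finset.card_eq_one]
    refine ⟨0, ?_⟩
    ext a
    simp only [Finset.mem_filter, Finset.mem_range, Finset.mem_singleton]
    constructor
    · rintro ⟨h, h'⟩
      interval_cases a
      · rfl
      · push_cast at h'; omega
    · rintro rfl
      exact ⟨two_pos, -k, by push_cast; ring⟩
  · rw [rootCount, Finset.card_eq_one]
    refine ⟨1, ?_⟩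
    ext a
    simp only [Finset.mem_filter, Finset.mem_range, Finset.mem_singleton]
    constructor
    · rintro ⟨h, h'⟩
      interval_cases a
      · push_cast at h'; omega
      · rfl
    · rintro rfl
      exact ⟨one_lt_two, -k, by push_cast; ring⟩

open Finset in
theorem rootCount_mul (n : ℤ) {a b : ℕ} (ha : a ≠ 0) (hb : b ≠ 0) (h : a.Coprime b) :
    rootCount n (a * b) = rootCount n a * rootCount n b := by
  have : NeZero a := ⟨ha⟩
  have : NeZero b := ⟨hb⟩
  rw [rootCount_eq_card_zmod, rootCount_eq_card_zmod, rootCount_eq_card_zmod,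
    ← Finset.card_product]
  refine Finset.card_bij (fun x _ => ZMod.chineseRemainder h x) ?_ ?_ ?_
  · intro x hx
    have := congrArg (ZMod.chineseRemainder h) (mem_filter.1 hx).2
    rw [map_pow, map_intCast, Prod.ext_iff] at this
    simpa using this
  · intro x _ y _ hxy
    exact (ZMod.chineseRemainder h).injective hxy
  · intro x hx
    refine ⟨(ZMod.chineseRemainder h).symm x, ?_, by simp⟩
    simp only [mem_filter, mem_univ, true_and, mem_product] at hx ⊢
    rw [← map_pow, RingEquiv.symm_apply_eq, map_intCast]
    exact Prod.ext hx.1 hx.2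

open Finset in
theorem rootCount_mul_sq_pow_add_two (n : ℤ) {p : ℕ} (hp : p.Prime) (k : ℕ) :
    rootCount (n * p ^ 2) (p ^ (k + 2)) = p * rootCount n (p ^ k) := by
  have hp0 : (p : ℤ) ^ 2 ≠ 0 := by exact_mod_cast pow_ne_zero 2 hp.ne_zero
  rw [rootCount, rootCount, Finset.card_filter, Finset.card_filter, ← smul_eq_mul (α := ℕ),
    ← sum_range_mul_of_periodic]
  · symm
    refine Finset.sum_of_injOn (fun a => p * a) ?_ ?_ ?_ ?_
    · intro a _ b _ h
      exact Nat.eq_of_mul_eq_mul_left hp.pos h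
    · intro a ha
      simp only [coe_range, Set.mem_Iio] at ha ⊢
      rw [show p ^ (k + 2) = p * (p ^ k * p) by ring]
      exact Nat.mul_lt_mul_of_pos_left ha hp.pos
    · intro b hb hb'
      rw [if_neg]
      intro h
      have hpb : (p : ℤ) ∣ (b : ℤ) ^ 2 := by
        have h1 : (p : ℤ) ∣ b ^ 2 - n * p ^ 2 := dvd_trans ⟨p ^ (k + 1), by push_cast; ring⟩ h
        exact (Int.dvd_iff_dvd_of_dvd_sub h1).2 ⟨n * p, by ring⟩
      have hpb : p ∣ b := by
        have := (Nat.prime_iff_prime_int.1 hp).dvd_of_dvd_pow hpb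
        exact_mod_cast this
      obtain ⟨a, rfl⟩ := hpb
      refine hb' ⟨a, ?_, rfl⟩
      simp only [coe_range, Set.mem_Iio, mem_range] at hb ⊢
      rw [show p ^ (k + 2) = p * (p ^ k * p) by ring] at hb
      exact Nat.lt_of_mul_lt_mul_left hb
    · intro a _
      have : ((p ^ (k + 2) : ℕ) : ℤ) ∣ ((p * a : ℕ) : ℤ) ^ 2 - n * p ^ 2 ↔
          ((p ^ k : ℕ) : ℤ) ∣ (a : ℤ) ^ 2 - n := by
        rw [show ((p * a : ℕ) : ℤ) ^ 2 - n * p ^ 2 = ((a : ℤ) ^ 2 - n) * p ^ 2 by push_cast; ring,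
          show ((p ^ (k + 2) : ℕ) : ℤ) = ((p ^ k : ℕ) : ℤ) * p ^ 2 by push_cast; ring]
        exact mul_dvd_mul_iff_right hp0
      simp only [this]
  · intro j
    have : ((p ^ k : ℕ) : ℤ) ∣ ((j + p ^ k : ℕ) : ℤ) ^ 2 - n ↔
        ((p ^ k : ℕ) : ℤ) ∣ (j : ℤ) ^ 2 - n := by
      apply Int.dvd_iff_dvd_of_dvd_sub
      exact ⟨2 * j + p ^ k, by push_cast; ring⟩
    simp only [this]

theorem rootCount_prime_of_dvd {n : ℤ} {p : ℕ} (hp : p.Prime) (h : (p : ℤ) ∣ n) :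
    rootCount n p = 1 := by
  rw [rootCount, Finset.card_eq_one]
  refine ⟨0, ?_⟩
  ext a
  simp only [Finset.mem_filter, Finset.mem_range, Finset.mem_singleton]
  constructor
  · rintro ⟨h1, h2⟩
    have h3 : (p : ℤ) ∣ (a : ℤ) := (Nat.prime_iff_prime_int.1 hp).dvd_of_dvd_pow
      ((Int.dvd_iff_dvd_of_dvd_sub h2).2 h)
    exact Nat.eq_zero_of_dvd_of_lt (by exact_mod_cast h3) h1
  · rintro rfl
    exact ⟨hp.pos, by simpa using h⟩

theorem rootCount_eq_zero {n : ℤ} {m : ℕ} (h : ∀ x : ℤ, ¬ (m : ℤ) ∣ x ^ 2 - n) :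
    rootCount n m = 0 := by
  rw [rootCount, Finset.card_eq_zero, Finset.filter_eq_empty_iff]
  intro a _
  exact h a

theorem rootCount_pow_add_two_of_not_sq_dvd {n : ℤ} {p : ℕ} (hp : p.Prime) (h : (p : ℤ) ∣ n)
    (h' : ¬ (p : ℤ) ^ 2 ∣ n) (k : ℕ) : rootCount n (p ^ (k + 2)) = 0 := by
  refine rootCount_eq_zero fun x hx => h' ?_
  have h2 : (p : ℤ) ^ 2 ∣ x ^ 2 - n := dvd_trans ⟨p ^ k, by push_cast; ring⟩ hx
  have h3 : (p : ℤ) ∣ x := (Nat.prime_iff_prime_int.1 hp).dvd_of_dvd_pow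
    ((Int.dvd_iff_dvd_of_dvd_sub (dvd_trans (dvd_pow_self _ two_ne_zero) h2)).2 h)
  exact (Int.dvd_iff_dvd_of_dvd_sub h2).1 (pow_dvd_pow_of_dvd h3 2)

theorem exists_pow_dvd_sq_sub {n : ℤ} {p : ℕ} (hp : p.Prime) (hp2 : p ≠ 2) (hn : ¬ (p : ℤ) ∣ n)
    {x₀ : ℤ} (hx₀ : (p : ℤ) ∣ x₀ ^ 2 - n) (k : ℕ) : ∃ x : ℤ, (p : ℤ) ^ (k + 1) ∣ x ^ 2 - n := by
  induction k with
  | zero => exact ⟨x₀, by simpa using hx₀⟩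
  | succ k ih =>
    obtain ⟨x, t, ht⟩ := ih
    have hpI := Nat.prime_iff_prime_int.1 hp
    have hpx : ¬ (p : ℤ) ∣ 2 * x := by
      intro h
      rcases hpI.dvd_or_dvd h with h | h
      · exact hp2 ((Nat.prime_dvd_prime_iff_eq hp Nat.prime_two).1 (by exact_mod_cast h))
      · refine hn ((Int.dvd_iff_dvd_of_dvd_sub (a := (p : ℤ)) (b := x ^ 2) (c := n) ?_).1
          (dvd_pow h two_ne_zero))
        rw [ht]
        exact dvd_mul_of_dvd_left (dvd_pow_self _ k.succ_ne_zero) _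
    obtain ⟨u, v, huv⟩ := (hpI.coprime_iff_not_dvd.2 hpx).symm
    refine ⟨x - p ^ (k + 1) * (u * t), v * t + p ^ k * (u * t) ^ 2, ?_⟩
    linear_combination ht - (p : ℤ) ^ (k + 1) * t * huv

theorem exists_two_pow_dvd_sq_sub {n : ℤ} (hn : n % 8 = 1) (k : ℕ) :
    ∃ x : ℤ, (2 : ℤ) ^ (k + 3) ∣ x ^ 2 - n := by
  induction k with
  | zero => exact ⟨1, by norm_num; omega⟩
  | succ k ih =>
    obtain ⟨x, t, ht⟩ := ih
    rcases Int.even_or_odd' t with ⟨u, rfl | rfl⟩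
    · exact ⟨x, u, by rw [ht]; ring⟩
    · have hx : x % 2 = 1 := by
        rcases Int.even_or_odd' x with ⟨y, rfl | rfl⟩
        · exfalso
          have : (2 * y) ^ 2 - n = 2 * (2 ^ (k + 2) * (2 * u + 1)) := by rw [ht]; ring
          have h2 : (2 * y) ^ 2 = 2 * (2 * y ^ 2) := by ring
          omega
        · omega
      obtain ⟨y, rfl⟩ : ∃ y, x = 2 * y + 1 := ⟨x / 2, by omega⟩
      exact ⟨2 * y + 1 + 2 ^ (k + 2), u + y + 1 + 2 ^ k, by linear_combination ht⟩

theorem rootCount_of_sq_dvd {n : ℤ} {p : ℕ} (hp : p.Prime) (hp2 : p ≠ 2) (hn : ¬ (p : ℤ) ∣ n)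
    {k : ℕ} {x : ℤ} (hx : (p : ℤ) ^ (k + 1) ∣ x ^ 2 - n) : rootCount n (p ^ (k + 1)) = 2 := by
  have hpI := Nat.prime_iff_prime_int.1 hp
  have : NeZero (p ^ (k + 1)) := ⟨pow_ne_zero _ hp.ne_zero⟩
  have hpx : ¬ (p : ℤ) ∣ 2 * x := by
    intro h
    rcases hpI.dvd_or_dvd h with h | h
    · exact hp2 ((Nat.prime_dvd_prime_iff_eq hp Nat.prime_two).1 (by exact_mod_cast h))
    · exact hn ((Int.dvd_iff_dvd_of_dvd_sub (dvd_trans (dvd_pow_self _ k.succ_ne_zero) hx)).1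
          (dvd_pow h two_ne_zero))
  have hx' : (x : ZMod (p ^ (k + 1))) ^ 2 = n := by
    rw [← sub_eq_zero]
    have := (ZMod.intCast_zmod_eq_zero_iff_dvd (x ^ 2 - n) (p ^ (k + 1))).2
      (by push_cast; exact hx)
    push_cast at this
    exact this
  rw [rootCount_eq_card_zmod, Finset.card_eq_two]
  refine ⟨x, -x, ?_, ?_⟩
  · intro h
    apply hpx
    have : ((2 * x : ℤ) : ZMod (p ^ (k + 1))) = 0 := by
      push_cast
      linear_combination h
    rw [ZMod.intCast_zmod_eq_zero_iff_dvd] at this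
    exact dvd_trans (by exact_mod_cast dvd_pow_self p k.succ_ne_zero) this
  · ext y
    simp only [Finset.mem_filter, Finset.mem_univ, true_and, Finset.mem_insert,
      Finset.mem_singleton]
    constructor
    · intro hy
      obtain ⟨y, rfl⟩ := ZMod.intCast_surjective y
      have h1 : ((p ^ (k + 1) : ℕ) : ℤ) ∣ (y - x) * (y + x) := by
        rw [← ZMod.intCast_zmod_eq_zero_iff_dvd]
        push_cast
        linear_combination hy - hx'
      push_cast at h1
      have h2 : ∀ z : ℤ, (p : ℤ) ^ (k + 1) ∣ z → (z : ZMod (p ^ (k + 1))) = 0 := by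
        intro z hz
        rw [ZMod.intCast_zmod_eq_zero_iff_dvd]
        exact_mod_cast hz
      by_cases h3 : (p : ℤ) ∣ y - x
      · left
        have h4 : ¬ (p : ℤ) ∣ y + x := by
          intro h4
          apply hpx
          have := dvd_sub h4 h3
          rwa [show y + x - (y - x) = 2 * x by ring] at this
        have := h2 _ ((hpI.coprime_iff_not_dvd.2 h4).pow_left.dvd_of_dvd_mul_right h1)
        push_cast at this
        linear_combination this
      · right
        have := h2 _ ((hpI.coprime_iff_not_dvd.2 h3).pow_left.dvd_of_dvd_mul_left h1)
        push_cast at this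
        linear_combination this
    · rintro (rfl | rfl)
      · exact hx'
      · rw [neg_sq, hx']

theorem rootCount_two_pow {n : ℤ} (hn : n % 8 = 1) (k : ℕ) : rootCount n (2 ^ (k + 3)) = 4 := by
  obtain ⟨x, hx⟩ := exists_two_pow_dvd_sq_sub hn k
  have hxodd : x % 2 = 1 := by
    rcases Int.even_or_odd' x with ⟨y, rfl | rfl⟩
    · exfalso
      have h1 : (2 : ℤ) ∣ (2 * y) ^ 2 - n := dvd_trans (dvd_pow_self _ (by omega)) hx
      have h2 : (2 * y) ^ 2 = 2 * (2 * y ^ 2) := by ring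
      omega
    · omega
  have hz : ∀ z : ℤ, (z : ZMod (2 ^ (k + 3))) = 0 ↔ (2 : ℤ) ^ (k + 3) ∣ z := by
    intro z
    rw [ZMod.intCast_zmod_eq_zero_iff_dvd]
    push_cast
    rfl
  set X : ZMod (2 ^ (k + 3)) := (x : ZMod (2 ^ (k + 3))) with hX
  have hx' : X ^ 2 = n := by
    rw [← sub_eq_zero]
    have := (hz (x ^ 2 - n)).2 hx
    push_cast at this
    exact this
  set h : ZMod (2 ^ (k + 3)) := ((2 ^ (k + 2) : ℤ) : ZMod (2 ^ (k + 3))) with hh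
  have hpow : (2 : ℤ) ^ (k + 3) = 2 ^ (k + 2) * 2 := by ring
  have hpow' : (2 : ℤ) ^ (k + 2) = 2 ^ (k + 1) * 2 := by ring
  have h2 : 2 * h = 0 := by
    have := (hz (2 * 2 ^ (k + 2))).2 ⟨1, by ring⟩
    push_cast at this
    rw [hh]
    push_cast
    exact this
  have hsq : h ^ 2 = 0 := by
    have := (hz ((2 ^ (k + 2)) ^ 2)).2 ⟨2 ^ (k + 1), by ring⟩
    rw [hh]
    exact_mod_cast this
  have hne : h ≠ 0 := by
    intro h0
    have := (hz _).1 h0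
    rw [hpow] at this
    obtain ⟨c, hc⟩ := this
    have h5 : (2 : ℤ) ^ (k + 2) ≠ 0 := by positivity
    have : (1 : ℤ) = 2 * c := mul_left_cancel₀ h5 (by linear_combination hc)
    omega
  have h2X : 2 * X ≠ 0 := by
    intro h0
    obtain ⟨c, hc⟩ := (hz (2 * x)).1 (by push_cast; exact h0)
    rw [hpow, hpow'] at hc
    have : x = 2 * (2 ^ (k + 1) * c) := by linarith
    omega
  have h2Xh : 2 * X ≠ h := by
    intro h0
    obtain ⟨c, hc⟩ := (hz (2 * x - 2 ^ (k + 2))).1 (by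
      push_cast
      rw [hh] at h0
      push_cast at h0
      linear_combination h0)
    have : x = 2 * (2 ^ k + 2 ^ (k + 1) * c) := by
      have : 2 * x = 2 * (2 * (2 ^ k + 2 ^ (k + 1) * c)) := by
        linear_combination hc
      linarith
    omega
  have hset : ({y : ZMod (2 ^ (k + 3)) | y ^ 2 = n} : Finset _) = {X, -X, X + h, -X + h} := by
    ext y
    simp only [Finset.mem_filter, Finset.mem_univ, true_and, Finset.mem_insert,
      Finset.mem_singleton]
    constructor
    · intro hy
      obtain ⟨y, rfl⟩ := ZMod.intCast_surjective y
      have h1 : (2 : ℤ) ^ (k + 3) ∣ (y - x) * (y + x) := by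
        rw [← hz]
        push_cast
        linear_combination hy - hx'
      have hyodd : y % 2 = 1 := by
        rcases Int.even_or_odd' y with ⟨z, rfl | rfl⟩
        · exfalso
          have h5 : (2 : ℤ) ∣ (2 * z - x) * (2 * z + x) :=
            dvd_trans (dvd_pow_self _ (by omega)) h1
          rcases Int.prime_two.dvd_or_dvd h5 with h5 | h5 <;> omega
        · omega
      have main : (2 : ℤ) ^ (k + 2) ∣ y - x ∨ (2 : ℤ) ^ (k + 2) ∣ y + x := by
        by_cases h3 : (4 : ℤ) ∣ y - x
        · left
          obtain ⟨a, ha⟩ : ∃ a, y + x = 2 * a := ⟨(y + x) / 2, by omega⟩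
          have hcop : IsCoprime ((2 : ℤ) ^ (k + 2)) a :=
            (Int.prime_two.coprime_iff_not_dvd.2 (by omega)).pow_left
          refine hcop.dvd_of_dvd_mul_right ?_
          rw [ha, hpow, show (y - x) * (2 * a) = (y - x) * a * 2 by ring] at h1
          exact (mul_dvd_mul_iff_right two_ne_zero).1 h1
        · right
          obtain ⟨a, ha⟩ : ∃ a, y - x = 2 * a := ⟨(y - x) / 2, by omega⟩
          have hcop : IsCoprime ((2 : ℤ) ^ (k + 2)) a :=
            (Int.prime_two.coprime_iff_not_dvd.2 (by omega)).pow_left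
          refine hcop.dvd_of_dvd_mul_left ?_
          rw [ha, hpow, show 2 * a * (y + x) = a * (y + x) * 2 by ring] at h1
          exact (mul_dvd_mul_iff_right two_ne_zero).1 h1
      have mult : ∀ z : ℤ, (2 : ℤ) ^ (k + 2) ∣ z → (z : ZMod (2 ^ (k + 3))) = 0 ∨
          (z : ZMod (2 ^ (k + 3))) = h := by
        rintro _ ⟨c, rfl⟩
        rcases Int.even_or_odd' c with ⟨e, rfl | rfl⟩
        · left
          rw [hz]
          exact ⟨e, by ring⟩
        · right
          rw [← sub_eq_zero, hh, ← Int.cast_sub, hz]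
          exact ⟨e, by ring⟩
      rcases main with hm | hm <;> rcases mult _ hm with hm | hm <;> push_cast at hm
      · left; linear_combination hm
      · right; right; left; linear_combination hm
      · right; left; linear_combination hm
      · right; right; right; linear_combination hm
    · rintro (rfl | rfl | rfl | rfl)
      · exact hx'
      · rw [neg_sq, hx']
      · linear_combination hx' + X * h2 + hsq
      · linear_combination hx' - X * h2 + hsq
  rw [rootCount_eq_card_zmod, hset, Finset.card_insert_of_notMem, Finset.card_insert_of_notMem,
    Finset.card_insert_of_notMem, Finset.card_singleton]
  · simp only [Finset.mem_singleton]
    intro h0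
    exact h2X (by linear_combination h0)
  · simp only [Finset.mem_singleton, Finset.mem_insert, not_or]
    refine ⟨fun h0 => h2Xh ?_, fun h0 => hne ?_⟩
    · linear_combination -h2 - h0
    · linear_combination -h0
  · simp only [Finset.mem_singleton, Finset.mem_insert, not_or]
    refine ⟨fun h0 => h2X ?_, fun h0 => hne ?_, fun h0 => h2Xh ?_⟩
    · linear_combination h0
    · linear_combination -h0
    · linear_combination h0

theorem rootCount_four {n : ℤ} (hn : n % 4 = 0 ∨ n % 4 = 1) : rootCount n 4 = 2 := by
  rcases hn with hn | hn
  · obtain ⟨m, rfl⟩ : ∃ m, n = m * (2 : ℕ) ^ 2 := ⟨n / 4, by push_cast; omega⟩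
    have := rootCount_mul_sq_pow_add_two m Nat.prime_two 0
    simpa [rootCount_one] using this
  · rw [rootCount, Finset.card_eq_two]
    refine ⟨1, 3, by norm_num, ?_⟩
    ext a
    simp only [Finset.mem_filter, Finset.mem_range, Finset.mem_insert, Finset.mem_singleton]
    constructor
    · rintro ⟨h, h'⟩
      interval_cases a <;> norm_num at h' ⊢ <;> omega
    · rintro (rfl | rfl)
      · exact ⟨by norm_num, -(n / 4), by push_cast; omega⟩
      · exact ⟨by norm_num, 2 - (n / 4), by push_cast; omega⟩

/-- The multiplicative function `m ↦ reducedGaussSum n m / m`. -/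
def normalizedGaussSum (n : ℤ) : ArithmeticFunction ℂ :=
  ⟨fun m => reducedGaussSum n m / m, by simp⟩

theorem normalizedGaussSum_apply (n : ℤ) (m : ℕ) :
    normalizedGaussSum n m = reducedGaussSum n m / m := rfl

open ArithmeticFunction in
theorem normalizedGaussSum_isMultiplicative (n : ℤ) : (normalizedGaussSum n).IsMultiplicative := by
  let R : ArithmeticFunction ℂ := ⟨fun m => rootCount n m, by simp [rootCount]⟩
  have hR : R.IsMultiplicative := by
    rw [IsMultiplicative.iff_ne_zero]
    refine ⟨by simp [R, rootCount_one], fun {a b} ha hb hab => ?_⟩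
    simp [R, rootCount_mul n ha hb hab]
  have h : normalizedGaussSum n * (zeta : ArithmeticFunction ℂ) = R := by
    ext m
    rw [coe_mul_zeta_apply]
    rcases Nat.eq_zero_or_pos m with rfl | hm
    · simp
    · exact sum_divisors_reducedGaussSum n hm
  have h2 : normalizedGaussSum n = R * (moebius : ArithmeticFunction ℂ) := by
    rw [← h, mul_assoc, coe_zeta_mul_coe_moebius, mul_one]
  rw [h2]
  exact hR.mul isMultiplicative_moebius.intCast

theorem normalizedGaussSum_prime_pow_succ (n : ℤ) {p : ℕ} (hp : p.Prime) (k : ℕ) :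
    normalizedGaussSum n (p ^ (k + 1)) = rootCount n (p ^ (k + 1)) - rootCount n (p ^ k) := by
  rw [← sum_divisors_reducedGaussSum n (pow_pos hp.pos _),
    ← sum_divisors_reducedGaussSum n (pow_pos hp.pos _), Nat.sum_divisors_prime_pow hp,
    Nat.sum_divisors_prime_pow hp, Finset.sum_range_succ _ (k + 1), normalizedGaussSum_apply]
  ring

theorem normalizedGaussSum_four {n : ℤ} (hn : n % 4 = 0 ∨ n % 4 = 1) :
    normalizedGaussSum n 4 = 1 := by
  have := normalizedGaussSum_prime_pow_succ n Nat.prime_two 1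
  norm_num [rootCount_two, rootCount_four hn] at this
  exact this

/-- The coefficient of `c ^ (-s)` in `En n s`. -/
def enCoeff (n : ℤ) (c : ℕ) : ℂ := 1 / 2 * ((if Odd c then gaussG c n else 0) + gaussG (2 * c) n)

theorem enCoeff_of_odd {n : ℤ} (hn : n % 4 = 0 ∨ n % 4 = 1) {c : ℕ} (hc : Odd c) :
    enCoeff n c = normalizedGaussSum n c := by
  have h4 : (4 : ℕ).Coprime c := by
    have : (2 ^ 2 : ℕ).Coprime c := (Nat.coprime_two_left.2 hc).pow_left 2
    simpa using this
  rw [enCoeff, if_pos hc, gaussG_of_odd hc, gaussG_two_mul hc.pos, ← normalizedGaussSum_apply,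
    ← normalizedGaussSum_apply, (normalizedGaussSum_isMultiplicative n).map_mul_of_coprime h4,
    normalizedGaussSum_four hn]
  ring

theorem enCoeff_of_even {n : ℤ} {c : ℕ} (hc : Even c) (hc0 : 0 < c) :
    enCoeff n c = 1 / 2 * normalizedGaussSum n (4 * c) := by
  rw [enCoeff, if_neg (by grind), gaussG_two_mul hc0, normalizedGaussSum_apply, zero_add]

theorem enCoeff_zero (n : ℤ) : enCoeff n 0 = 0 := by
  simp [enCoeff, gaussG]

theorem enCoeff_one {n : ℤ} (hn : n % 4 = 0 ∨ n % 4 = 1) : enCoeff n 1 = 1 := by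
  rw [enCoeff_of_odd hn odd_one, (normalizedGaussSum_isMultiplicative n).map_one]

theorem enCoeff_mul {n : ℤ} (hn : n % 4 = 0 ∨ n % 4 = 1) {a b : ℕ} (h : a.Coprime b) :
    enCoeff n (a * b) = enCoeff n a * enCoeff n b := by
  have hm := normalizedGaussSum_isMultiplicative n
  rcases Nat.eq_zero_or_pos a with rfl | ha0
  · simp [enCoeff_zero]
  rcases Nat.eq_zero_or_pos b with rfl | hb0
  · simp [enCoeff_zero]
  have key : ∀ {a b : ℕ}, a.Coprime b → 0 < a → 0 < b → Even a → Odd b →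
      enCoeff n (a * b) = enCoeff n a * enCoeff n b := by
    intro a b h ha0 hb0 ha hb
    have h4 : (4 * a).Coprime b := by
      have : (2 ^ 2 : ℕ).Coprime b := (Nat.coprime_two_left.2 hb).pow_left 2
      exact Nat.Coprime.mul_left (by simpa using this) h
    rw [enCoeff_of_even (by grind) (by positivity), enCoeff_of_even ha ha0, enCoeff_of_odd hn hb,
      ← mul_assoc 4, hm.map_mul_of_coprime h4, mul_assoc]
  rcases Nat.even_or_odd a with ha | ha <;> rcases Nat.even_or_odd b with hb | hb
  · exact absurd (Nat.dvd_gcd ha.two_dvd hb.two_dvd) (by rw [h]; norm_num)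
  · exact key h ha0 hb0 ha hb
  · rw [mul_comm a, key h.symm hb0 ha0 hb ha, mul_comm]
  · rw [enCoeff_of_odd hn (ha.mul hb), enCoeff_of_odd hn ha, enCoeff_of_odd hn hb,
      hm.map_mul_of_coprime h]

/-- The normalised number of square roots of `n` modulo `p ^ k`; at `p = 2` one counts half the
square roots modulo `2 ^ (k + 2)`. -/
def localCount (n : ℤ) (p k : ℕ) : ℂ :=
  if p = 2 then rootCount n (2 ^ (k + 2)) / 2 else rootCount n (p ^ k)

theorem enCoeff_prime_pow_succ {n : ℤ} (hn : n % 4 = 0 ∨ n % 4 = 1) {p : ℕ} (hp : p.Prime)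
    (k : ℕ) : enCoeff n (p ^ (k + 1)) = localCount n p (k + 1) - localCount n p k := by
  rw [localCount, localCount]
  split_ifs with h
  · subst h
    rw [enCoeff_of_even (by simp [parity_simps]) (by positivity),
      show 4 * 2 ^ (k + 1) = 2 ^ (k + 2 + 1) by ring, normalizedGaussSum_prime_pow_succ n hp]
    ring
  · rw [enCoeff_of_odd hn ((hp.odd_of_ne_two h).pow), normalizedGaussSum_prime_pow_succ n hp]

theorem localCount_zero {n : ℤ} (hn : n % 4 = 0 ∨ n % 4 = 1) (p : ℕ) : localCount n p 0 = 1 := by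
  rw [localCount]
  split_ifs
  · simp [rootCount_four hn]
  · simp [rootCount_one]

theorem localCount_mul_sq_one (n : ℤ) {p : ℕ} (hp : p.Prime) : localCount (n * p ^ 2) p 1 = 1 := by
  rw [localCount]
  split_ifs with h
  · subst h
    rw [rootCount_mul_sq_pow_add_two n hp, pow_one, rootCount_two]
    norm_num
  · rw [pow_one, rootCount_prime_of_dvd hp (dvd_mul_of_dvd_right (dvd_pow_self _ two_ne_zero) _)]
    norm_num

theorem localCount_mul_sq_add_two (n : ℤ) {p : ℕ} (hp : p.Prime) (k : ℕ) :
    localCount (n * p ^ 2) p (k + 2) = p * localCount n p k := by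
  rw [localCount, localCount]
  split_ifs with h
  · subst h
    rw [rootCount_mul_sq_pow_add_two n hp]
    push_cast
    ring
  · rw [rootCount_mul_sq_pow_add_two n hp]
    push_cast
    ring

theorem IsFundDisc.emod_four {d : ℤ} (hd : IsFundDisc d) : d % 4 = 0 ∨ d % 4 = 1 := by
  rcases hd with rfl | ⟨_, h, _⟩ | ⟨m, rfl, _⟩ <;> omega

theorem IsFundDisc.not_sq_dvd {d : ℤ} (hd : IsFundDisc d) {p : ℕ} (hp : p.Prime) (hp2 : p ≠ 2) :
    ¬ (p : ℤ) ^ 2 ∣ d := by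
  have hpI := Nat.prime_iff_prime_int.1 hp
  have hsq : ∀ m : ℤ, Squarefree m → ¬ (p : ℤ) ^ 2 ∣ m := fun m hm h =>
    hpI.not_isUnit (hm p (by rwa [← sq]))
  rcases hd with rfl | ⟨h, _⟩ | ⟨m, rfl, h, _⟩
  · exact hsq 1 squarefree_one
  · exact hsq d h
  · intro h'
    refine hsq m h ?_
    refine IsCoprime.dvd_of_dvd_mul_left (y := 4) ?_ h'
    refine (hpI.coprime_iff_not_dvd.2 fun h4 => hp2 ?_).pow_left
    have h4 : (p : ℤ) ∣ 2 := hpI.dvd_of_dvd_pow (n := 2) (by simpa using h4)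
    exact (Nat.prime_dvd_prime_iff_eq hp Nat.prime_two).1 (by exact_mod_cast h4)

theorem localCount_two_base {d : ℤ} (hd : IsFundDisc d) {f : ℤ} (hf : f % 2 = 1) (k : ℕ) :
    localCount (d * f ^ 2) 2 (k + 1) = (chiPrime d 2 : ℂ) ^ (k + 1) + (chiPrime d 2 : ℂ) ^ k := by
  obtain ⟨g, rfl⟩ : ∃ g, f = 2 * g + 1 := ⟨f / 2, by omega⟩
  obtain ⟨t, ht⟩ : ∃ t, g * (g + 1) = 2 * t := (Int.even_mul_succ_self g).two_dvd
  have hf2 : (2 * g + 1) ^ 2 = 8 * t + 1 := by linear_combination 4 * ht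
  rw [localCount, if_pos rfl, chiPrime, if_pos rfl]
  by_cases hd2 : d % 2 = 0
  · rw [if_pos hd2]
    obtain ⟨m, rfl, -, hm⟩ : ∃ m : ℤ, d = 4 * m ∧ Squarefree m ∧ (m % 4 = 2 ∨ m % 4 = 3) := by
      rcases hd with rfl | ⟨_, h, _⟩ | h
      · omega
      · omega
      · exact h
    rw [show 4 * m * (2 * g + 1) ^ 2 = m * (2 * g + 1) ^ 2 * (2 : ℕ) ^ 2 by push_cast; ring,
      show k + 1 + 2 = k + 1 + 2 by rfl, rootCount_mul_sq_pow_add_two _ Nat.prime_two]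
    rcases k with _ | k
    · rw [zero_add, pow_one, rootCount_two]
      norm_num
    · rw [rootCount_eq_zero]
      · simp
      · intro x hx
        have h4 : (4 : ℤ) ∣ x ^ 2 - m * (2 * g + 1) ^ 2 :=
          dvd_trans ⟨2 ^ k, by push_cast; ring⟩ hx
        have hmod : (m * (2 * g + 1) ^ 2) % 4 = m % 4 := by
          rw [hf2, show m * (8 * t + 1) = m + 4 * (2 * m * t) by ring, Int.add_mul_emod_self_left]
        rcases Int.even_or_odd' x with ⟨y, rfl | rfl⟩
        · have : (2 * y) ^ 2 = 4 * y ^ 2 := by ring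
          omega
        · have : (2 * y + 1) ^ 2 = 4 * (y ^ 2 + y) + 1 := by ring
          omega
  · rw [if_neg hd2]
    have hmod : (d * (2 * g + 1) ^ 2) % 8 = d % 8 := by
      rw [hf2, show d * (8 * t + 1) = d + 8 * (d * t) by ring, Int.add_mul_emod_self_left]
    have hd4 := hd.emod_four
    split_ifs with h8
    · rw [rootCount_two_pow (by omega)]
      norm_num
    · rw [rootCount_eq_zero]
      · push_cast
        ring
      · intro x hx
        have h8' : (8 : ℤ) ∣ x ^ 2 - d * (2 * g + 1) ^ 2 :=
          dvd_trans ⟨2 ^ k, by push_cast; ring⟩ hx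
        rcases Int.even_or_odd' x with ⟨y, rfl | rfl⟩
        · have : (2 * y) ^ 2 = 4 * y ^ 2 := by ring
          omega
        · obtain ⟨u, hu⟩ : ∃ u, y * (y + 1) = 2 * u := (Int.even_mul_succ_self y).two_dvd
          have : (2 * y + 1) ^ 2 = 8 * u + 1 := by linear_combination 4 * hu
          omega

theorem localCount_odd_base {d : ℤ} (hd : IsFundDisc d) {p : ℕ} (hp : p.Prime) (hp2 : p ≠ 2)
    {f : ℤ} (hf : ¬ (p : ℤ) ∣ f) (k : ℕ) :
    localCount (d * f ^ 2) p (k + 1) = (chiPrime d p : ℂ) ^ (k + 1) + (chiPrime d p : ℂ) ^ k := by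
  have hpI := Nat.prime_iff_prime_int.1 hp
  have : Fact p.Prime := ⟨hp⟩
  have hf' : ((f : ℤ) : ZMod p) ≠ 0 := by rwa [Ne, ZMod.intCast_zmod_eq_zero_iff_dvd]
  have hfp : ¬ (p : ℤ) ∣ f ^ 2 := fun h => hf (hpI.dvd_of_dvd_pow h)
  have hχ : chiPrime d p = legendreSym p (d * f ^ 2) := by
    rw [chiPrime, if_neg hp2, legendreSym.mul, legendreSym.sq_one' p hf', mul_one,
      jacobiSym.legendreSym.to_jacobiSym]
  rw [localCount, if_neg hp2, hχ]
  by_cases hpd : (p : ℤ) ∣ d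
  · have hdvd : (p : ℤ) ∣ d * f ^ 2 := hpd.mul_right _
    rw [(legendreSym.eq_zero_iff p _).2 ((ZMod.intCast_zmod_eq_zero_iff_dvd _ p).2 hdvd)]
    rcases k with _ | k
    · rw [zero_add, pow_one, rootCount_prime_of_dvd hp hdvd]
      norm_num
    · rw [rootCount_pow_add_two_of_not_sq_dvd hp hdvd]
      · simp
      · intro h
        refine hd.not_sq_dvd hp hp2 ?_
        exact (hpI.coprime_iff_not_dvd.2 hfp).pow_left.dvd_of_dvd_mul_right h
  · have hdvd : ¬ (p : ℤ) ∣ d * f ^ 2 := fun h => (hpI.dvd_or_dvd h).elim hpd hfp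
    have hne : ((d * f ^ 2 : ℤ) : ZMod p) ≠ 0 := by rwa [Ne, ZMod.intCast_zmod_eq_zero_iff_dvd]
    by_cases hsq : IsSquare ((d * f ^ 2 : ℤ) : ZMod p)
    · rw [(legendreSym.eq_one_iff p hne).2 hsq]
      obtain ⟨x, hx⟩ := hsq
      obtain ⟨x, rfl⟩ := ZMod.intCast_surjective x
      have hx' : (p : ℤ) ∣ x ^ 2 - d * f ^ 2 := by
        rw [← ZMod.intCast_zmod_eq_zero_iff_dvd, Int.cast_sub, hx]
        push_cast
        ring
      obtain ⟨y, hy⟩ := exists_pow_dvd_sq_sub hp hp2 hdvd hx' k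
      rw [rootCount_of_sq_dvd hp hp2 hdvd hy]
      norm_num
    · rw [(legendreSym.eq_neg_one_iff p).2 hsq, rootCount_eq_zero]
      · push_cast
        ring
      · intro x hx
        refine hsq ⟨x, ?_⟩
        have : (p : ℤ) ∣ x ^ 2 - d * f ^ 2 :=
          dvd_trans (by push_cast; exact dvd_pow_self _ k.succ_ne_zero) hx
        have := (ZMod.intCast_zmod_eq_zero_iff_dvd _ p).2 this
        push_cast at this ⊢
        linear_combination -this

theorem localCount_base {d : ℤ} (hd : IsFundDisc d) {p : ℕ} (hp : p.Prime)
    {f : ℤ} (hf : ¬ (p : ℤ) ∣ f) (k : ℕ) :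
    localCount (d * f ^ 2) p (k + 1) = (chiPrime d p : ℂ) ^ (k + 1) + (chiPrime d p : ℂ) ^ k := by
  by_cases hp2 : p = 2
  · subst hp2
    exact localCount_two_base hd (by push_cast at hf; omega) k
  · exact localCount_odd_base hd hp hp2 hf k

theorem norm_lamb_le_one (a c : ℕ) : ‖lamb a c‖ ≤ 1 := by
  have hJ : ∀ (x : ℤ) (y : ℕ), ‖(jacobiSym x y : ℂ)‖ ≤ 1 := by
    intro x y
    rcases jacobiSym.trichotomy x y with h | h | h <;> simp [h]
  have hE : ∀ t : ℝ, ‖cexp (Real.pi * I * t / 2)‖ = 1 := by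
    intro t
    rw [show (Real.pi * I * t / 2 : ℂ) = ((Real.pi * t / 2 : ℝ) : ℂ) * I by push_cast; ring,
      norm_exp_ofReal_mul_I]
  rw [lamb]
  split_ifs
  · have := hE ((1 - c) / 2)
    push_cast at this
    rw [norm_mul, this, one_mul]
    exact hJ _ _
  · have := hE (a / 2)
    push_cast at this
    rw [norm_mul, this, one_mul]
    exact hJ _ _
  · simp

theorem norm_gaussG_le (c : ℕ) (n : ℤ) : ‖gaussG c n‖ ≤ 2 * Real.sqrt c := by
  rcases Nat.eq_zero_or_pos c with rfl | hc
  · simp [gaussG]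
  have hcR : (0 : ℝ) < c := by exact_mod_cast hc
  have h1 : ‖∑ a ∈ Finset.Icc 1 (2 * c), lamb a c * cexp (-Real.pi * I * n * a / c)‖ ≤ 2 * c := by
    refine (norm_sum_le_of_le _ (f := fun a => lamb a c * cexp (-Real.pi * I * n * a / c))
      (n := fun _ => 1) fun a _ => ?_).trans (by simp)
    rw [norm_mul, show (-Real.pi * I * n * a / c : ℂ) = ((-Real.pi * n * a / c : ℝ) : ℂ) * I by
      push_cast; ring, norm_exp_ofReal_mul_I, mul_one]
    exact norm_lamb_le_one a c
  have h2 : ‖(c : ℂ) ^ (-(1 : ℂ) / 2)‖ = (Real.sqrt c)⁻¹ := by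
    rw [norm_natCast_cpow_of_pos hc, Real.sqrt_eq_rpow, ← Real.rpow_neg hcR.le]
    norm_num
  rw [gaussG, norm_mul, h2]
  calc (Real.sqrt c)⁻¹ * _ ≤ (Real.sqrt c)⁻¹ * (2 * c) := by gcongr
    _ = 2 * Real.sqrt c := by
      have : Real.sqrt c ≠ 0 := by positivity
      field_simp
      rw [Real.sq_sqrt hcR.le]

theorem summable_norm_mul_cpow {F : ℕ → ℂ} {K : ℝ} (hF : ∀ c, ‖F c‖ ≤ K * Real.sqrt c) {s : ℂ}
    (hs : 3 / 2 < s.re) : Summable fun c : ℕ => ‖F c * (c : ℂ) ^ (-s)‖ := by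
  have h := (Real.summable_nat_rpow (p := 1 / 2 - s.re)).2 (by linarith)
  refine Summable.of_nonneg_of_le (fun _ => norm_nonneg _) (fun c => ?_) (h.mul_left K)
  rcases Nat.eq_zero_or_pos c with rfl | hc
  · have := hF 0
    simp only [Nat.cast_zero, Real.sqrt_zero, mul_zero, norm_le_zero_iff] at this
    have h0 : 1 / 2 - s.re ≠ 0 := (by linarith : 1 / 2 - s.re < 0).ne
    rw [this, zero_mul, norm_zero, Nat.cast_zero, Real.zero_rpow h0, mul_zero]
  · have hcR : (0 : ℝ) < c := by exact_mod_cast hc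
    rw [norm_mul, norm_natCast_cpow_of_pos hc, sub_eq_add_neg, Real.rpow_add hcR,
      ← Real.sqrt_eq_rpow, ← mul_assoc, neg_re]
    gcongr
    exact hF c

theorem norm_gaussG_two_mul_le (c : ℕ) (n : ℤ) : ‖gaussG (2 * c) n‖ ≤ 4 * Real.sqrt c := by
  refine (norm_gaussG_le _ n).trans ?_
  have h : Real.sqrt 2 ≤ 2 := Real.sqrt_le_iff.2 ⟨by norm_num, by norm_num⟩
  push_cast
  rw [Real.sqrt_mul (by norm_num)]
  nlinarith [Real.sqrt_nonneg (c : ℝ)]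

theorem norm_enCoeff_le (n : ℤ) (c : ℕ) : ‖enCoeff n c‖ ≤ 3 * Real.sqrt c := by
  have h1 : ‖if Odd c then gaussG c n else 0‖ ≤ 2 * Real.sqrt c := by
    split_ifs
    · exact norm_gaussG_le c n
    · simp
  have h2 := norm_gaussG_two_mul_le c n
  rw [enCoeff, norm_mul]
  have h3 := norm_add_le (if Odd c then gaussG c n else 0) (gaussG (2 * c) n)
  norm_num
  linarith

theorem En_eq_tsum (n : ℤ) {s : ℂ} (hs : 3 / 2 < s.re) :
    En n s = ∑' c : ℕ, enCoeff n c * (c : ℂ) ^ (-s) := by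
  have h1 : ∀ c : ℕ, (if Odd c then gaussG c n * (c : ℂ) ^ (-s) else 0) =
      (if Odd c then gaussG c n else 0) * (c : ℂ) ^ (-s) := by
    intro c
    split_ifs <;> simp
  have h2 : (∑' c : ℕ, if Even c ∧ c ≠ 0 then gaussG c n * ((c : ℂ) / 2) ^ (-s) else 0) =
      ∑' c : ℕ, gaussG (2 * c) n * (c : ℂ) ^ (-s) := by
    have hinj : Function.Injective fun c : ℕ => 2 * c := fun a b h => by simpa using h
    rw [← hinj.tsum_eq]
    · refine tsum_congr fun c => ?_
      rcases Nat.eq_zero_or_pos c with rfl | hc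
      · simp [gaussG]
      · rw [if_pos ⟨even_two_mul c, by omega⟩]
        congr 2
        push_cast
        field_simp
    · intro c hc
      have : Even c := by
        by_contra h
        simp [h] at hc
      obtain ⟨m, rfl⟩ := this.two_dvd
      exact ⟨m, rfl⟩
  have s1 : Summable fun c : ℕ => (if Odd c then gaussG c n else 0) * (c : ℂ) ^ (-s) := by
    refine (summable_norm_mul_cpow (K := 2) (fun c => ?_) hs).of_norm
    split_ifs
    · exact norm_gaussG_le c n
    · simp
  have s2 : Summable fun c : ℕ => gaussG (2 * c) n * (c : ℂ) ^ (-s) :=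
    (summable_norm_mul_cpow (fun c => norm_gaussG_two_mul_le c n) hs).of_norm
  rw [En, h2, tsum_congr h1, ← mul_add, ← s1.tsum_add s2, ← tsum_mul_left]
  refine tsum_congr fun c => ?_
  rw [enCoeff]
  ring

theorem chi_mul (d : ℤ) {a b : ℕ} (ha : a ≠ 0) (hb : b ≠ 0) :
    chi d (a * b) = chi d a * chi d b := by
  rw [chi, Nat.factorization_mul ha hb, Finsupp.prod_add_index']
  · rfl
  · simp
  · intro p i j
    exact pow_add _ _ _

theorem chi_one (d : ℤ) : chi d 1 = 1 := by
  simp [chi]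

theorem chi_prime (d : ℤ) {p : ℕ} (hp : p.Prime) : chi d p = chiPrime d p := by
  rw [chi, hp.factorization, Finsupp.prod_single_index] <;> simp

theorem norm_chiPrime_le_one (d : ℤ) (p : ℕ) : ‖(chiPrime d p : ℂ)‖ ≤ 1 := by
  rw [chiPrime]
  split_ifs
  · simp
  · simp
  · simp
  · rcases jacobiSym.trichotomy d p with h | h | h <;> simp [h]

theorem norm_chi_le_one (d : ℤ) (m : ℕ) : ‖(chi d m : ℂ)‖ ≤ 1 := by
  rw [chi, Finsupp.prod]
  push_cast
  rw [norm_prod]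
  refine Finset.prod_le_one (fun _ _ => norm_nonneg _) fun p _ => ?_
  rw [norm_pow]
  exact pow_le_one₀ (norm_nonneg _) (norm_chiPrime_le_one d p)

/-- The completely multiplicative function `m ↦ χ_d(m) m ^ (-s)`. -/
def chiHom (d : ℤ) (s : ℂ) : ℕ →*₀ ℂ where
  toFun m := if m = 0 then 0 else (chi d m : ℂ) * (m : ℂ) ^ (-s)
  map_zero' := if_pos rfl
  map_one' := by simp [chi_one]
  map_mul' a b := by
    rcases eq_or_ne a 0 with rfl | ha
    · simp
    rcases eq_or_ne b 0 with rfl | hb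
    · simp
    rw [if_neg (mul_ne_zero ha hb), if_neg ha, if_neg hb, chi_mul d ha hb]
    push_cast
    rw [natCast_mul_natCast_cpow]
    ring

theorem chiHom_apply_prime (d : ℤ) (s : ℂ) {p : ℕ} (hp : p.Prime) :
    chiHom d s p = chiPrime d p * (p : ℂ) ^ (-s) := by
  rw [← chi_prime d hp]
  exact if_neg hp.ne_zero

theorem hasProd_Lchi (d : ℤ) {s : ℂ} (hs : 1 < s.re) :
    HasProd (fun p : Nat.Primes => (1 - (chiPrime d p : ℂ) * (p : ℂ) ^ (-s))⁻¹) (Lchi d s) := by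
  have hsum : Summable fun m => ‖chiHom d s m‖ := by
    refine Summable.of_nonneg_of_le (fun _ => norm_nonneg _) (fun m => ?_)
      ((Real.summable_nat_rpow (p := -s.re)).2 (by linarith))
    rcases Nat.eq_zero_or_pos m with rfl | hm
    · simp only [map_zero, norm_zero]
      positivity
    · have : chiHom d s m = (chi d m : ℂ) * (m : ℂ) ^ (-s) := if_neg hm.ne'
      rw [this, norm_mul, norm_natCast_cpow_of_pos hm, neg_re]
      exact mul_le_of_le_one_left (by positivity) (norm_chi_le_one d m)
  have e : (fun p : Nat.Primes => (1 - (chiPrime d p : ℂ) * (p : ℂ) ^ (-s))⁻¹) =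
      fun p : Nat.Primes => (1 - chiHom d s p)⁻¹ :=
    funext fun p => by rw [chiHom_apply_prime d s p.2]
  rw [e]
  exact EulerProduct.eulerProduct_completely_multiplicative_hasProd hsum

theorem natCast_pow_cpow (p k : ℕ) (w : ℂ) : ((p ^ k : ℕ) : ℂ) ^ w = ((p : ℂ) ^ w) ^ k := by
  induction k with
  | zero => simp
  | succ k ih => rw [pow_succ, pow_succ, ← ih, Nat.cast_mul, natCast_mul_natCast_cpow]

theorem sigmaC_prime_pow_succ (w : ℂ) {p : ℕ} (hp : p.Prime) (k : ℕ) :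
    sigmaC w (p ^ (k + 1)) = sigmaC w (p ^ k) + ((p : ℂ) ^ w) ^ (k + 1) := by
  rw [sigmaC, sigmaC, Nat.sum_divisors_prime_pow hp, Nat.sum_divisors_prime_pow hp,
    Finset.sum_range_succ _ (k + 1), natCast_pow_cpow]

theorem sigmaC_one (w : ℂ) : sigmaC w 1 = 1 := by
  simp [sigmaC]

theorem Tchi_one (d : ℤ) (s : ℂ) : Tchi d s 1 = 1 := by
  simp [Tchi, chi_one, sigmaC_one]

theorem Tchi_prime_pow_succ (d : ℤ) (s : ℂ) {p : ℕ} (hp : p.Prime) (k : ℕ) :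
    Tchi d s (p ^ (k + 1)) = sigmaC (2 * s - 1) (p ^ (k + 1)) -
      chiPrime d p * (p : ℂ) ^ (s - 1) * sigmaC (2 * s - 1) (p ^ k) := by
  rw [Tchi, Nat.sum_divisors_prime_pow hp, Finset.sum_range_succ', Finset.sum_range_succ',
    Finset.sum_eq_zero]
  · rw [zero_add, pow_one, ArithmeticFunction.moebius_apply_prime hp, chi_prime d hp,
      pow_succ p k, Nat.mul_div_cancel _ hp.pos]
    simp [chi_one]
    ring
  · intro j _
    rw [ArithmeticFunction.moebius_apply_prime_pow hp (by omega), if_neg (by omega)]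
    simp

/-- The correction factor `T_s^χ(f) / f ^ (2 * s - 1)`. -/
def Tratio (d : ℤ) (s : ℂ) (f : ℕ) : ℂ := Tchi d s f / (f : ℂ) ^ (2 * s - 1)

theorem Tratio_one (d : ℤ) (s : ℂ) : Tratio d s 1 = 1 := by
  simp [Tratio, Tchi_one]

theorem Tratio_prime_pow_succ (d : ℤ) (s : ℂ) {p : ℕ} (hp : p.Prime) (k : ℕ) :
    Tratio d s (p ^ (k + 1)) = 1 - chiPrime d p * (p : ℂ) ^ (-s) +
      p * ((p : ℂ) ^ (-s)) ^ 2 * Tratio d s (p ^ k) := by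
  have hp0 : (p : ℂ) ≠ 0 := by exact_mod_cast hp.ne_zero
  have hX : (p : ℂ) ^ (-s) ≠ 0 := by simp [cpow_eq_zero_iff, hp0]
  have hQ : (p : ℂ) ^ (2 * s - 1) ≠ 0 := by simp [cpow_eq_zero_iff, hp0]
  have hq : p * ((p : ℂ) ^ (-s)) ^ 2 = ((p : ℂ) ^ (2 * s - 1))⁻¹ := by
    rw [← cpow_nat_mul, ← cpow_neg]
    nth_rw 1 [← cpow_one (p : ℂ)]
    rw [← cpow_add _ _ hp0]
    congr 1
    push_cast
    ring
  have hs1 : (p : ℂ) ^ (s - 1) = (p : ℂ) ^ (2 * s - 1) * (p : ℂ) ^ (-s) := by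
    rw [← cpow_add _ _ hp0]
    congr 1
    ring
  rw [Tratio, Tratio, natCast_pow_cpow, natCast_pow_cpow, hq]
  rcases k with _ | k
  · rw [Tchi_prime_pow_succ d s hp, sigmaC_prime_pow_succ _ hp, hs1]
    simp only [pow_zero, sigmaC_one, Tchi_one, zero_add, pow_one]
    field_simp
    ring
  · rw [Tchi_prime_pow_succ d s hp, Tchi_prime_pow_succ d s hp, sigmaC_prime_pow_succ _ hp (k + 1),
      sigmaC_prime_pow_succ _ hp k, hs1]
    generalize (p : ℂ) ^ (2 * s - 1) = Q at hQ
    field_simp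
    ring

/-- The function `m ↦ m ^ w` for `m ≠ 0`, extended by zero. -/
def cpowFun (w : ℂ) : ArithmeticFunction ℂ := ⟨fun m => if m = 0 then 0 else (m : ℂ) ^ w, if_pos rfl⟩

theorem cpowFun_apply (w : ℂ) {m : ℕ} (hm : m ≠ 0) : cpowFun w m = (m : ℂ) ^ w := if_neg hm

open ArithmeticFunction in
theorem cpowFun_isMultiplicative (w : ℂ) : (cpowFun w).IsMultiplicative := by
  rw [IsMultiplicative.iff_ne_zero]
  refine ⟨by simp [cpowFun_apply], fun {a b} ha hb _ => ?_⟩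
  rw [cpowFun_apply w (mul_ne_zero ha hb), cpowFun_apply w ha, cpowFun_apply w hb, Nat.cast_mul,
    natCast_mul_natCast_cpow]

open ArithmeticFunction in
theorem Tratio_eq_prod (d : ℤ) (s : ℂ) {f : ℕ} (hf : f ≠ 0) :
    Tratio d s f = f.factorization.prod fun p k => Tratio d s (p ^ k) := by
  let χ : ArithmeticFunction ℂ := ⟨fun m => if m = 0 then 0 else (chi d m : ℂ), if_pos rfl⟩
  have hχ : χ.IsMultiplicative := by
    rw [IsMultiplicative.iff_ne_zero]
    refine ⟨by simp [χ, chi_one], fun {a b} ha hb _ => ?_⟩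
    simp [χ, ha, hb, chi_mul d ha hb]
  let S : ArithmeticFunction ℂ := cpowFun (2 * s - 1) * (zeta : ArithmeticFunction ℂ)
  have hS : S.IsMultiplicative := (cpowFun_isMultiplicative _).mul isMultiplicative_zeta.natCast
  have hS' : ∀ m, S m = sigmaC (2 * s - 1) m := by
    intro m
    rw [coe_mul_zeta_apply, sigmaC]
    refine Finset.sum_congr rfl fun t ht => cpowFun_apply _ (Nat.pos_of_mem_divisors ht).ne'
  let A : ArithmeticFunction ℂ := ((moebius : ArithmeticFunction ℂ).pmul χ).pmul (cpowFun (s - 1))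
  have hA : A.IsMultiplicative :=
    (isMultiplicative_moebius.intCast.pmul hχ).pmul (cpowFun_isMultiplicative _)
  have hT : ∀ m, (A * S) m = Tchi d s m := by
    intro m
    rw [mul_apply, Nat.sum_divisorsAntidiagonal (fun a b => A a * S b), Tchi]
    refine Finset.sum_congr rfl fun a ha => ?_
    have ha0 := (Nat.pos_of_mem_divisors ha).ne'
    have hA' : A a = (moebius a : ℂ) * chi d a * (a : ℂ) ^ (s - 1) := by
      rw [pmul_apply, pmul_apply, cpowFun_apply _ ha0, intCoe_apply,
        show χ a = (chi d a : ℂ) from if_neg ha0]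
    rw [hS', hA']
  let R : ArithmeticFunction ℂ := (A * S).pmul (cpowFun (-(2 * s - 1)))
  have hR : R.IsMultiplicative := (hA.mul hS).pmul (cpowFun_isMultiplicative _)
  have hR' : ∀ m, m ≠ 0 → R m = Tratio d s m := by
    intro m hm
    rw [pmul_apply, hT, cpowFun_apply _ hm, cpow_neg, Tratio, div_eq_mul_inv]
  rw [← hR' f hf, hR.multiplicative_factorization R hf]
  refine Finsupp.prod_congr fun p hp => hR' _ ?_
  exact pow_ne_zero _ (Nat.prime_of_mem_primeFactors (by simpa using hp)).ne_zero

theorem hasProd_Tratio (d : ℤ) (s : ℂ) {f : ℕ} (hf : f ≠ 0) :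
    HasProd (fun p : Nat.Primes => Tratio d s (p ^ f.factorization p)) (Tratio d s f) := by
  have h : HasProd (fun p : ℕ => Tratio d s (p ^ f.factorization p)) (Tratio d s f) := by
    rw [Tratio_eq_prod d s hf]
    refine hasProd_prod_of_ne_finset_one fun p hp => ?_
    rw [Finsupp.notMem_support_iff.1 hp, pow_zero, Tratio_one]
  refine (Function.Injective.hasProd_iff Subtype.val_injective fun p hp => ?_).2 h
  have : ¬ p.Prime := fun h' => hp ⟨⟨p, h'⟩, rfl⟩
  rw [Nat.factorization_eq_zero_of_not_prime _ this, pow_zero, Tratio_one]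

theorem hasSum_enCoeff_base {d : ℤ} (hd : IsFundDisc d) {p : ℕ} (hp : p.Prime) {f : ℤ}
    (hf : ¬ (p : ℤ) ∣ f) (hn : (d * f ^ 2) % 4 = 0 ∨ (d * f ^ 2) % 4 = 1) {X : ℂ} (hX : ‖X‖ < 1) :
    HasSum (fun k => enCoeff (d * f ^ 2) (p ^ k) * X ^ k)
      ((1 - X ^ 2) * (1 - chiPrime d p * X)⁻¹) := by
  set χ : ℂ := ((chiPrime d p : ℤ) : ℂ) with hχ
  have hχX : ‖χ * X‖ < 1 := by
    rw [norm_mul]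
    exact (mul_le_of_le_one_left (norm_nonneg _) (norm_chiPrime_le_one d p)).trans_lt hX
  have hg := hasSum_geometric_of_norm_lt_one hχX
  have h1 : 1 - χ * X ≠ 0 := by
    intro h
    have : χ * X = 1 := by linear_combination -h
    rw [this] at hχX
    simp at hχX
  rw [← hasSum_nat_add_iff' 2] at hg ⊢
  have hb0 : enCoeff (d * f ^ 2) 1 = 1 := enCoeff_one hn
  have hb1 : enCoeff (d * f ^ 2) p = χ := by
    have := enCoeff_prime_pow_succ hn hp 0
    rw [localCount_base hd hp hf, localCount_zero hn] at this
    simpa using this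
  have hb : ∀ k, enCoeff (d * f ^ 2) (p ^ (k + 2)) = χ ^ (k + 2) - χ ^ k := by
    intro k
    rw [enCoeff_prime_pow_succ hn hp, localCount_base hd hp hf, localCount_base hd hp hf]
    ring
  have hg2 := hasSum_geometric_of_norm_lt_one hχX
  convert hg.sub (hg2.mul_left (X ^ 2)) using 1
  · ext k
    rw [hb, mul_pow, mul_pow]
    ring
  · simp only [Finset.sum_range_succ, Finset.sum_range_zero, pow_zero, pow_one, hb0, hb1]
    ring

theorem hasSum_enCoeff_mul_sq {n : ℤ} (hn : n % 4 = 0 ∨ n % 4 = 1) {p : ℕ} (hp : p.Prime)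
    (hn' : (n * p ^ 2) % 4 = 0 ∨ (n * p ^ 2) % 4 = 1) {X B : ℂ}
    (h : HasSum (fun k => enCoeff n (p ^ k) * X ^ k) B) :
    HasSum (fun k => enCoeff (n * p ^ 2) (p ^ k) * X ^ k) (1 - X ^ 2 + p * X ^ 2 * B) := by
  have hb0 : enCoeff (n * p ^ 2) 1 = 1 := enCoeff_one hn'
  have hb1 : enCoeff (n * p ^ 2) p = 0 := by
    have := enCoeff_prime_pow_succ hn' hp 0
    rw [zero_add, localCount_mul_sq_one n hp, localCount_zero hn'] at this
    simpa using this
  have hb : ∀ k, enCoeff (n * p ^ 2) (p ^ (k + 2)) =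
      p * enCoeff n (p ^ k) - if k = 0 then 1 else 0 := by
    rintro (_ | k)
    · rw [enCoeff_prime_pow_succ hn' hp, localCount_mul_sq_add_two n hp,
        localCount_mul_sq_one n hp, localCount_zero hn, pow_zero, enCoeff_one hn]
      simp
    · rw [enCoeff_prime_pow_succ hn' hp, localCount_mul_sq_add_two n hp,
        localCount_mul_sq_add_two n hp, enCoeff_prime_pow_succ hn hp]
      simp
      ring
  rw [← hasSum_nat_add_iff' 2]
  convert (h.mul_left (p * X ^ 2)).sub (hasSum_ite_eq 0 (X ^ 2)) using 1
  · ext k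
    rw [hb]
    split_ifs with hk
    · subst hk
      ring
    · ring
  · simp only [Finset.sum_range_succ, Finset.sum_range_zero, pow_zero, pow_one, hb0, hb1]
    ring

theorem IsFundDisc.mul_sq_emod_four {d : ℤ} (hd : IsFundDisc d) (f : ℤ) :
    (d * f ^ 2) % 4 = 0 ∨ (d * f ^ 2) % 4 = 1 := by
  have h := hd.emod_four
  have hf : f ^ 2 % 4 = 0 ∨ f ^ 2 % 4 = 1 := by
    rcases Int.even_or_odd' f with ⟨y, rfl | rfl⟩
    · left
      have : (2 * y) ^ 2 = 4 * y ^ 2 := by ring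
      omega
    · right
      have : (2 * y + 1) ^ 2 = 4 * (y ^ 2 + y) + 1 := by ring
      omega
  rw [Int.mul_emod]
  rcases h with h | h <;> rcases hf with hf | hf <;> simp [h, hf]

theorem hasSum_enCoeff {d : ℤ} (hd : IsFundDisc d) {p : ℕ} (hp : p.Prime) {f : ℤ}
    (hf : ¬ (p : ℤ) ∣ f) {s : ℂ} (hs : 0 < s.re) (v : ℕ) :
    HasSum (fun k => enCoeff (d * (f * p ^ v) ^ 2) (p ^ k) * ((p : ℂ) ^ (-s)) ^ k)
      ((1 - ((p : ℂ) ^ (-s)) ^ 2) * (1 - chiPrime d p * (p : ℂ) ^ (-s))⁻¹ *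
        Tratio d s (p ^ v)) := by
  have hX : ‖(p : ℂ) ^ (-s)‖ < 1 := by
    rw [norm_natCast_cpow_of_pos hp.pos, neg_re]
    exact Real.rpow_lt_one_of_one_lt_of_neg (by exact_mod_cast hp.one_lt) (by linarith)
  induction v with
  | zero =>
    rw [pow_zero, mul_one, pow_zero, Tratio_one, mul_one]
    exact hasSum_enCoeff_base hd hp hf (hd.mul_sq_emod_four f) hX
  | succ v ih =>
    have e : d * (f * p ^ (v + 1)) ^ 2 = d * (f * p ^ v) ^ 2 * p ^ 2 := by ring
    have := hasSum_enCoeff_mul_sq (hd.mul_sq_emod_four _) hp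
      (by rw [← e]; exact hd.mul_sq_emod_four _) ih
    rw [e]
    convert this using 1
    have hχX : 1 - (chiPrime d p : ℂ) * (p : ℂ) ^ (-s) ≠ 0 := by
      intro h
      have h' : (chiPrime d p : ℂ) * (p : ℂ) ^ (-s) = 1 := by linear_combination -h
      have := (mul_le_of_le_one_left (norm_nonneg ((p : ℂ) ^ (-s)))
        (norm_chiPrime_le_one d p)).trans_lt hX
      rw [← norm_mul, h'] at this
      simp at this
    rw [Tratio_prime_pow_succ d s hp]
    linear_combination (1 - ((p : ℂ) ^ (-s)) ^ 2) * mul_inv_cancel₀ hχX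

/-- Zagier: for n ≡ 0, 1 (mod 4), n = d f² with d a fundamental discriminant,
E_n(s) = (L(s,χ_d)/ζ(2s)) · T_s^{χ_d}(f)/f^{2s−1}. -/
theorem En_eq_Lseries (n : ℤ) (hn : n ≠ 0) (h4 : n % 4 = 0 ∨ n % 4 = 1)
    (d : ℤ) (f : ℕ) (hf : 0 < f) (hd : IsFundDisc d) (hdf : n = d * (f : ℤ) ^ 2)
    (s : ℂ) (hs : 3/2 < s.re) :
    En n s = (Lchi d s / riemannZeta (2 * s)) * (Tchi d s f / (f : ℂ) ^ (2 * s - 1)) := by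
  have h2s : 1 < (2 * s).re := by
    simp only [mul_re, re_ofNat, im_ofNat, zero_mul, sub_zero]
    linarith
  have hζ := riemannZeta_ne_zero_of_one_lt_re h2s
  have hE : HasProd (fun p : Nat.Primes => ∑' e : ℕ, enCoeff n ((p : ℕ) ^ e) *
      (((p : ℕ) ^ e : ℕ) : ℂ) ^ (-s)) (∑' c : ℕ, enCoeff n c * (c : ℂ) ^ (-s)) := by
    refine EulerProduct.eulerProduct_hasProd (f := fun c : ℕ => enCoeff n c * (c : ℂ) ^ (-s))
      ?_ ?_ (summable_norm_mul_cpow (norm_enCoeff_le n) hs) ?_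
    · simp [enCoeff_one h4]
    · intro a b hab
      simp only [enCoeff_mul h4 hab, Nat.cast_mul, natCast_mul_natCast_cpow]
      ring
    · simp [enCoeff_zero]
  rw [← En_eq_tsum n hs] at hE
  have hlocal : ∀ p : Nat.Primes, (∑' e : ℕ, enCoeff n ((p : ℕ) ^ e) *
      (((p : ℕ) ^ e : ℕ) : ℂ) ^ (-s)) = (1 - (((p : ℕ) : ℂ) ^ (-s)) ^ 2) *
        (1 - chiPrime d p * ((p : ℕ) : ℂ) ^ (-s))⁻¹ * Tratio d s (p ^ f.factorization p) := by
    intro p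
    have hf' : n = d * (((f / (p : ℕ) ^ f.factorization p : ℕ) : ℤ) *
        ((p : ℕ) : ℤ) ^ f.factorization p) ^ 2 := by
      rw [hdf]
      congr 2
      exact_mod_cast (Nat.div_mul_cancel (Nat.ordProj_dvd f p)).symm
    have hnd : ¬ (((p : ℕ) : ℤ) ∣ ((f / (p : ℕ) ^ f.factorization p : ℕ) : ℤ)) := by
      exact_mod_cast Nat.not_dvd_ordCompl p.2 hf.ne'
    have := hasSum_enCoeff hd p.2 hnd (s := s) (by linarith) (f.factorization p)
    rw [← hf'] at this
    rw [← this.tsum_eq]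
    exact tsum_congr fun k => by rw [natCast_pow_cpow]
  have hZ := riemannZeta_eulerProduct_hasProd h2s
  have h1 := hE.mul hZ
  have h2 := (hasProd_Lchi d (by linarith : 1 < s.re)).mul (hasProd_Tratio d s hf.ne')
  have key : En n s * riemannZeta (2 * s) = Lchi d s * Tratio d s f := by
    refine h1.unique ?_
    convert h2 using 2 with p
    rw [hlocal]
    have hp2 : ((p : ℕ) : ℂ) ^ (-(2 * s)) = (((p : ℕ) : ℂ) ^ (-s)) ^ 2 := by
      rw [← cpow_nat_mul]
      congr 1
      push_cast
      ring
    have hX : 1 - (((p : ℕ) : ℂ) ^ (-s)) ^ 2 ≠ 0 := by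
      rw [← hp2, sub_ne_zero]
      intro h
      have h' := congrArg norm h
      rw [norm_natCast_cpow_of_pos p.2.pos, norm_one, neg_re] at h'
      exact absurd h'.symm (Real.rpow_lt_one_of_one_lt_of_neg
        (by exact_mod_cast p.2.one_lt) (by linarith)).ne
    rw [hp2]
    field_simp
  rw [← Tratio, div_mul_eq_mul_div, eq_div_iff hζ, key]

end
end
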